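/- Let G be a topological group. The set of values of p ∈ (0,∞) such that G admits a continuous affine isometric action on an L_p space with unbounded orbits is upward closed: if 0 < p < q < ∞ and G admits a continuous affine isometric action on some L_p space with an unbounded orbit, then G admits a continuous affine isometric action on some L_q space with an unbounded orbit. -/

import Mathlib

open MeasureTheory ENNReal

/-- The quantity `‖f‖_p^p = ∫ |f|^p dμ`, valued in `ℝ≥0∞`.  This is the natural way to
measure the size of an element of an `L_p` space for any `0 < p < ∞`. -/
noncomputable def pPow {X : Type*} [MeasurableSpace X] (μ : Measure X) (p : ℝ)
    (f : X →ₘ[μ] ℂ) : ℝ≥0∞ :=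
  ∫⁻ x, (‖f x‖₊ : ℝ≥0∞) ^ p ∂μ

/-- A continuous affine isometric action of a topological group `G` on `L_p(X,μ)`:
a group homomorphism from `G` to the group of surjective affine isometries of
`L_p(X,μ)`, such that `g ↦ α_g f` is continuous for every `f`.  (Surjectivity of each
`act g` is automatic from the group laws.)  Isometry is expressed via the quantity
`pPow μ p` (i.e. `‖·‖_p^p`), and continuity via convergence in `L_p`, which makes sense
for every `0 < p < ∞`, including `p < 1`. -/
structure AffineIsometricAction (G : Type*) [Group G] [TopologicalSpace G]
    {X : Type*} [MeasurableSpace X] (μ : Measure X) (p : ℝ) where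
  act : G → Lp ℂ (ENNReal.ofReal p) μ → Lp ℂ (ENNReal.ofReal p) μ
  act_one : ∀ f, act 1 f = f
  act_mul : ∀ g h f, act (g * h) f = act g (act h f)
  isometry : ∀ g f f',
    pPow μ p ((act g f : X →ₘ[μ] ℂ) - (act g f' : X →ₘ[μ] ℂ))
      = pPow μ p ((f : X →ₘ[μ] ℂ) - (f' : X →ₘ[μ] ℂ))
  affine : ∀ (g : G) (t : ℝ) (f f' : Lp ℂ (ENNReal.ofReal p) μ),
    act g (t • f + (1 - t) • f') = t • act g f + (1 - t) • act g f'
  continuous : ∀ (f : Lp ℂ (ENNReal.ofReal p) μ) (g₀ : G),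
    Filter.Tendsto (fun g => pPow μ p ((act g f : X →ₘ[μ] ℂ) - (act g₀ f : X →ₘ[μ] ℂ)))
      (nhds g₀) (nhds 0)

/-- An affine isometric action has an *unbounded orbit* if for some `f` the set
`{α_g f : g ∈ G}` is unbounded in the `L_p` (quasi-)norm. -/
def AffineIsometricAction.HasUnboundedOrbit {G : Type*} [Group G] [TopologicalSpace G]
    {X : Type*} [MeasurableSpace X] {μ : Measure X} {p : ℝ}
    (α : AffineIsometricAction G μ p) : Prop :=
  ∃ f : Lp ℂ (ENNReal.ofReal p) μ,
    ¬ ∃ C : ℝ≥0∞, C ≠ ⊤ ∧ ∀ g : G, pPow μ p ((α.act g f : X →ₘ[μ] ℂ)) ≤ C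


open Filter Topology

/-- The integral of `‖F‖^q` for a function. -/
noncomputable def NN {Y : Type*} [MeasurableSpace Y] {E : Type*} [NormedAddCommGroup E]
    (ν : Measure Y) (q : ℝ) (F : Y → E) : ℝ≥0∞ := ∫⁻ y, ‖F y‖ₑ ^ q ∂ν

section NNlemmas

variable {Y : Type*} [MeasurableSpace Y] {E : Type*} [NormedAddCommGroup E]
  {ν : Measure Y} {q : ℝ}

lemma NN_congr {F F' : Y → E} (h : F =ᵐ[ν] F') : NN ν q F = NN ν q F' := by
  unfold NN
  apply lintegral_congr_ae
  filter_upwards [h] with y hy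
  rw [hy]

lemma pPow_eq_NN (f : Y →ₘ[ν] ℂ) : pPow ν q f = NN ν q (f : Y → ℂ) := rfl

lemma rpow_add_le' (hq : 0 < q) (a b : ℝ≥0∞) :
    (a + b) ^ q ≤ (2 : ℝ≥0∞) ^ q * (a ^ q + b ^ q) := by
  rcases le_total a b with h | h
  · calc (a + b) ^ q ≤ (2 * b) ^ q := by
          apply ENNReal.rpow_le_rpow _ hq.le
          rw [two_mul]; gcongr
      _ = 2 ^ q * b ^ q := ENNReal.mul_rpow_of_nonneg _ _ hq.le
      _ ≤ _ := by gcongr; exact le_add_self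
  · calc (a + b) ^ q ≤ (2 * a) ^ q := by
          apply ENNReal.rpow_le_rpow _ hq.le
          rw [two_mul]; gcongr
      _ = 2 ^ q * a ^ q := ENNReal.mul_rpow_of_nonneg _ _ hq.le
      _ ≤ _ := by gcongr; exact le_self_add

lemma NN_le_add (hq : 0 < q) {E1 E2 : Type*} [NormedAddCommGroup E1] [NormedAddCommGroup E2]
    {F : Y → E} {F1 : Y → E1} {F2 : Y → E2}
    (hm : AEStronglyMeasurable F1 ν) (h : ∀ᵐ y ∂ν, ‖F y‖ ≤ ‖F1 y‖ + ‖F2 y‖) :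
    NN ν q F ≤ 2 ^ q * (NN ν q F1 + NN ν q F2) := by
  unfold NN
  rw [← lintegral_add_left' (hm.enorm.pow_const q), ← lintegral_const_mul' _ _ (by
    exact ENNReal.rpow_ne_top_of_nonneg hq.le (by simp))]
  apply lintegral_mono_ae
  filter_upwards [h] with y hy
  refine le_trans ?_ (rpow_add_le' hq _ _)
  apply ENNReal.rpow_le_rpow _ hq.le
  rw [← ofReal_norm, ← ofReal_norm, ← ofReal_norm, ← ENNReal.ofReal_add (norm_nonneg _) (norm_nonneg _)]
  exact ENNReal.ofReal_le_ofReal hy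

lemma NN_comp {Y' : Type*} [MeasurableSpace Y'] {ν' : Measure Y'} {K : Y → Y'}
    (hK : MeasurePreserving K ν ν') {F : Y' → E}
    (hF : AEStronglyMeasurable F ν') : NN ν q (fun y => F (K y)) = NN ν' q F := by
  have h1 : (fun y => F (K y)) =ᵐ[ν] fun y => hF.mk F (K y) :=
    hK.quasiMeasurePreserving.ae_eq_comp hF.ae_eq_mk
  rw [NN_congr h1, NN_congr hF.ae_eq_mk]
  exact hK.lintegral_comp (f := fun y => ‖hF.mk F y‖ₑ ^ q)
    (hF.stronglyMeasurable_mk.enorm.pow_const q)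

lemma NN_sub_comm (F F' : Y → E) : NN ν q (fun y => F y - F' y) = NN ν q (fun y => F' y - F y) := by
  unfold NN
  congr 1; ext y
  rw [← enorm_neg, neg_sub]

lemma NN_const_smul_le (hq : 0 < q) (L : ℝ) (F : Y → E) {E1 : Type*} [NormedAddCommGroup E1]
    (F1 : Y → E1) (h : ∀ y, ‖F1 y‖ ≤ L * ‖F y‖) :
    NN ν q F1 ≤ (ENNReal.ofReal L) ^ q * NN ν q F := by
  unfold NN
  rw [← lintegral_const_mul' _ _ (ENNReal.rpow_ne_top_of_nonneg hq.le (by simp))]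
  apply lintegral_mono
  intro y
  dsimp only
  rw [← ENNReal.mul_rpow_of_nonneg _ _ hq.le]
  apply ENNReal.rpow_le_rpow _ hq.le
  rw [← ofReal_norm, ← ofReal_norm]
  by_cases hL : 0 ≤ L
  · rw [← ENNReal.ofReal_mul hL]
    exact ENNReal.ofReal_le_ofReal (h y)
  · have : ‖F1 y‖ ≤ 0 := (h y).trans (mul_nonpos_of_nonpos_of_nonneg (by linarith) (norm_nonneg _))
    rw [ENNReal.ofReal_of_nonpos this]; exact zero_le

lemma memLp_iff_NN (hq : 0 < q) {F : Y → E} :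
    MemLp F (ENNReal.ofReal q) ν ↔ AEStronglyMeasurable F ν ∧ NN ν q F < ⊤ := by
  unfold MemLp NN
  rw [eLpNorm_lt_top_iff_lintegral_rpow_enorm_lt_top (by simpa using hq) (by simp),
    ENNReal.toReal_ofReal hq.le]

lemma eLpNorm_eq_NN (hq : 0 < q) (F : Y → E) :
    eLpNorm F (ENNReal.ofReal q) ν = (NN ν q F) ^ (1 / q) := by
  unfold NN
  rw [eLpNorm_eq_lintegral_rpow_enorm_toReal (by simpa using hq) (by simp),
    ENNReal.toReal_ofReal hq.le]

lemma NN_zero (hq : 0 < q) : NN ν q (fun _ : Y => (0 : E)) = 0 := by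
  simp [NN, hq]

lemma NN_eq_zero_iff (hq : 0 < q) {F : Y → E} (hF : AEStronglyMeasurable F ν) :
    NN ν q F = 0 ↔ F =ᵐ[ν] 0 := by
  unfold NN
  rw [lintegral_eq_zero_iff' (hF.enorm.pow_const q)]
  constructor
  · intro h
    filter_upwards [h] with y hy
    simpa [hq, hq.le, hq.not_gt] using hy
  · intro h
    filter_upwards [h] with y hy
    simp [hy, hq]

end NNlemmas

section Cont

variable {G : Type*} [TopologicalSpace G] {Y : Type*} [MeasurableSpace Y]
  {E : Type*} [NormedAddCommGroup E] {ν : Measure Y} {q : ℝ} {K : G → Y → Y}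

/-- Continuity of `g ↦ F ∘ K_g` in `L_q`. -/
def CC (ν : Measure Y) (q : ℝ) (K : G → Y → Y) (F : Y → E) : Prop :=
  ∀ g₀, Tendsto (fun g => NN ν q (fun y => F (K g y) - F (K g₀ y))) (𝓝 g₀) (𝓝 0)

lemma CC_of_le (hq : 0 < q) (hK : ∀ g, MeasurePreserving (K g) ν ν)
    {E1 E2 : Type*} [NormedAddCommGroup E1] [NormedAddCommGroup E2] {F : Y → E}
    {F1 : Y → E1} {F2 : Y → E2} (L : ℝ) (h1 : CC ν q K F1) (h2 : CC ν q K F2)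
    (hF1 : AEStronglyMeasurable F1 ν)
    (h : ∀ y y', ‖F y - F y'‖ ≤ L * (‖F1 y - F1 y'‖ + ‖F2 y - F2 y'‖)) : CC ν q K F := by
  intro g₀
  have key : ∀ g, NN ν q (fun y => F (K g y) - F (K g₀ y)) ≤
      (ENNReal.ofReal L) ^ q * (2 ^ q * (NN ν q (fun y => F1 (K g y) - F1 (K g₀ y)) +
        NN ν q (fun y => F2 (K g y) - F2 (K g₀ y)))) := by
    intro g
    refine (NN_const_smul_le hq L
      (fun y => ‖F1 (K g y) - F1 (K g₀ y)‖ + ‖F2 (K g y) - F2 (K g₀ y)‖) _ ?_).trans ?_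
    · intro y
      refine (h _ _).trans (le_of_eq ?_)
      rw [Real.norm_of_nonneg (by positivity)]
    · gcongr
      apply NN_le_add hq
      · exact (hF1.comp_measurePreserving (hK g)).sub (hF1.comp_measurePreserving (hK g₀))
      · filter_upwards with y
        rw [Real.norm_of_nonneg (by positivity)]
  refine tendsto_of_tendsto_of_tendsto_of_le_of_le tendsto_const_nhds ?_ (fun _ => zero_le) key
  have : (0 : ℝ≥0∞) = (ENNReal.ofReal L) ^ q * (2 ^ q * (0 + 0)) := by simp
  rw [this]
  refine ENNReal.Tendsto.const_mul (ENNReal.Tendsto.const_mul ((h1 g₀).add (h2 g₀)) ?_) ?_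
  · right; exact ENNReal.rpow_ne_top_of_nonneg hq.le (by simp)
  · right; exact ENNReal.rpow_ne_top_of_nonneg hq.le (by simp)

lemma CC_approx (hq : 0 < q) (hK : ∀ g, MeasurePreserving (K g) ν ν)
    {F : Y → E} (hF : AEStronglyMeasurable F ν)
    (h : ∀ ε : ℝ≥0∞, ε ≠ 0 → ∃ F' : Y → E, AEStronglyMeasurable F' ν ∧ CC ν q K F' ∧
      NN ν q (fun y => F y - F' y) ≤ ε) : CC ν q K F := by
  intro g₀
  rw [ENNReal.tendsto_nhds_zero]
  intro ε hε
  set C : ℝ≥0∞ := 2 ^ q with hC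
  have hCt : C ≠ ⊤ := ENNReal.rpow_ne_top_of_nonneg hq.le (by simp)
  set D : ℝ≥0∞ := C * (1 + C * (1 + 1)) with hD
  have hDt : D ≠ ⊤ := by
    rw [hD]; finiteness
  have hD0 : D ≠ 0 := by
    have : C ≠ 0 := by
      rw [hC]; simp
    simp [hD, this]
  obtain ⟨F', hF', hc, hN⟩ := h (ε / D) (by simp [hε.ne', hDt])
  have h3 := ENNReal.tendsto_nhds_zero.1 (hc g₀) (ε / D)
    (ENNReal.div_pos hε.ne' hDt)
  filter_upwards [h3] with g hg
  have hm : ∀ g, AEStronglyMeasurable (fun y => F (K g y)) ν := fun g =>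
    hF.comp_measurePreserving (hK g)
  have hm' : ∀ g, AEStronglyMeasurable (fun y => F' (K g y)) ν := fun g =>
    hF'.comp_measurePreserving (hK g)
  have e1 : ∀ g, NN ν q (fun y => F (K g y) - F' (K g y)) ≤ ε / D := fun g => by
    rw [NN_comp (hK g) (F := fun y => F y - F' y) (hF.sub hF')]; exact hN
  have e2 : NN ν q (fun y => F' (K g y) - F (K g₀ y)) ≤ C * (ε / D + ε / D) := by
    refine (NN_le_add hq (F1 := fun y => F' (K g y) - F' (K g₀ y))
      (F2 := fun y => F' (K g₀ y) - F (K g₀ y)) ((hm' g).sub (hm' g₀)) ?_).trans ?_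
    · filter_upwards with y
      exact norm_sub_le_norm_sub_add_norm_sub _ _ _
    · rw [NN_sub_comm (fun y => F' (K g₀ y))]
      gcongr
      exact e1 g₀
  refine (NN_le_add hq (F1 := fun y => F (K g y) - F' (K g y))
      (F2 := fun y => F' (K g y) - F (K g₀ y)) ((hm g).sub (hm' g)) ?_).trans ?_
  · filter_upwards with y
    exact norm_sub_le_norm_sub_add_norm_sub _ _ _
  · calc C * (NN ν q (fun y => F (K g y) - F' (K g y)) + NN ν q (fun y => F' (K g y) - F (K g₀ y)))
        ≤ C * (ε / D + C * (ε / D + ε / D)) := by gcongr; exact e1 g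
      _ = D * (ε / D) := by rw [hD]; ring
      _ = ε := ENNReal.mul_div_cancel hD0 hDt

/-- Continuity for a set. -/
def DD (ν : Measure Y) (q : ℝ) (K : G → Y → Y) (B : Set Y) : Prop :=
  CC ν q K (B.indicator (fun _ => (1 : ℝ)))

lemma ind_meas {B : Set Y} (hB : MeasurableSet B) :
    AEStronglyMeasurable (B.indicator (fun _ => (1 : ℝ))) ν :=
  (stronglyMeasurable_const.indicator hB).aestronglyMeasurable

lemma DD_congr (hK : ∀ g, MeasurePreserving (K g) ν ν) {B B' : Set Y} (h : B =ᵐ[ν] B')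
    (hB : DD ν q K B) : DD ν q K B' := by
  intro g₀
  refine (hB g₀).congr ?_
  intro g
  apply NN_congr
  have h0 := indicator_ae_eq_of_ae_eq_set (f := fun _ => (1 : ℝ)) h
  filter_upwards [(hK g).quasiMeasurePreserving.ae_eq_comp h0,
    (hK g₀).quasiMeasurePreserving.ae_eq_comp h0] with y h1 h2
  simp only [Function.comp] at h1 h2
  rw [h1, h2]

lemma DD_inter (hq : 0 < q) (hK : ∀ g, MeasurePreserving (K g) ν ν) {A B : Set Y}
    (hA : MeasurableSet A) (h1 : DD ν q K A) (h2 : DD ν q K B) : DD ν q K (A ∩ B) := by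
  refine CC_of_le hq hK 1 h1 h2 (ind_meas hA) ?_
  intro y y'
  by_cases a : y ∈ A <;> by_cases b : y ∈ B <;> by_cases c : y' ∈ A <;> by_cases d : y' ∈ B <;>
    simp [Set.indicator, a, b, c, d]

lemma DD_union (hq : 0 < q) (hK : ∀ g, MeasurePreserving (K g) ν ν) {A B : Set Y}
    (hA : MeasurableSet A) (h1 : DD ν q K A) (h2 : DD ν q K B) : DD ν q K (A ∪ B) := by
  refine CC_of_le hq hK 1 h1 h2 (ind_meas hA) ?_
  intro y y'
  by_cases a : y ∈ A <;> by_cases b : y ∈ B <;> by_cases c : y' ∈ A <;> by_cases d : y' ∈ B <;>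
    simp [Set.indicator, a, b, c, d]

lemma DD_diff (hq : 0 < q) (hK : ∀ g, MeasurePreserving (K g) ν ν) {A B : Set Y}
    (hA : MeasurableSet A) (h1 : DD ν q K A) (h2 : DD ν q K B) : DD ν q K (A \ B) := by
  refine CC_of_le hq hK 1 h1 h2 (ind_meas hA) ?_
  intro y y'
  by_cases a : y ∈ A <;> by_cases b : y ∈ B <;> by_cases c : y' ∈ A <;> by_cases d : y' ∈ B <;>
    simp [Set.indicator, a, b, c, d]

lemma DD_empty (hq : 0 < q) : DD ν q K ∅ := by
  intro g₀
  simp [NN_zero hq]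

lemma DD_iUnion (hq : 0 < q) (hK : ∀ g, MeasurePreserving (K g) ν ν) {B : ℕ → Set Y}
    (hB : ∀ n, MeasurableSet (B n)) (h : ∀ n, DD ν q K (B n)) (hfin : ν (⋃ n, B n) ≠ ⊤) :
    DD ν q K (⋃ n, B n) := by
  have hacc : ∀ n, MeasurableSet (Set.accumulate B n) ∧ DD ν q K (Set.accumulate B n) := by
    intro n
    induction n with
    | zero => simpa [Set.accumulate_zero_nat] using ⟨hB 0, h 0⟩
    | succ n ih =>
      rw [Set.accumulate_succ]
      exact ⟨ih.1.union (hB _), DD_union hq hK ih.1 ih.2 (h _)⟩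
  refine CC_approx hq hK (ind_meas (MeasurableSet.iUnion hB)) ?_
  intro ε hε
  have ht := tendsto_measure_iUnion_accumulate (μ := ν) (f := B)
  have hd : Tendsto (fun n => ν (⋃ n, B n) - ν (Set.accumulate B n)) atTop (𝓝 0) := by
    have := ENNReal.Tendsto.sub (tendsto_const_nhds (x := ν (⋃ n, B n))) ht (Or.inl hfin)
    simpa using this
  obtain ⟨n, hn⟩ := (ENNReal.tendsto_nhds_zero.1 hd ε (pos_iff_ne_zero.2 hε)).exists
  refine ⟨_, ind_meas (hacc n).1, (hacc n).2, le_trans ?_ hn⟩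
  have hsub : Set.accumulate B n ⊆ ⋃ n, B n := Set.accumulate_subset_iUnion n
  rw [← measure_sdiff hsub (hacc n).1.nullMeasurableSet (measure_ne_top_of_subset hsub hfin),
    ← lintegral_indicator_one ((MeasurableSet.iUnion hB).diff (hacc n).1)]
  apply lintegral_mono
  intro y
  by_cases a : y ∈ Set.accumulate B n
  · have b := hsub a
    simp only [Set.indicator_of_mem a, Set.indicator_of_mem b, sub_self, enorm_zero,
      ENNReal.zero_rpow_of_pos hq]
    exact zero_le
  · by_cases b : y ∈ ⋃ n, B n
    · simp only [Set.indicator_of_notMem a, Set.indicator_of_mem b]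
      rw [Set.indicator_of_mem (show y ∈ (⋃ n, B n) \ Set.accumulate B n from ⟨b, a⟩)]
      simp
    · simp only [Set.indicator_of_notMem a, Set.indicator_of_notMem b]
      simp [hq]

lemma DD_iUnion' (hq : 0 < q) (hK : ∀ g, MeasurePreserving (K g) ν ν) {ι : Type*} [Countable ι]
    {B : ι → Set Y}
    (hB : ∀ n, MeasurableSet (B n)) (h : ∀ n, DD ν q K (B n)) (hfin : ν (⋃ n, B n) ≠ ⊤) :
    DD ν q K (⋃ n, B n) := by
  rcases isEmpty_or_nonempty ι with hι | hι
  · simp [DD_empty hq]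
  · obtain ⟨e, he⟩ := exists_surjective_nat ι
    rw [← he.iUnion_comp] at hfin ⊢
    exact DD_iUnion hq hK (fun n => hB (e n)) (fun n => h (e n)) hfin

lemma level_fin (hq : 0 < q) {F : Y → ℝ} (hF : Measurable F)
    (hN : NN ν q F < ⊤) {ε : ℝ} (hε : 0 < ε) : ν {y | ε < F y} < ⊤ := by
  have h1 : {y | ε < F y} ⊆ {y | (ENNReal.ofReal ε) ^ q ≤ ‖F y‖ₑ ^ q} := by
    intro y hy
    apply ENNReal.rpow_le_rpow _ hq.le
    rw [← ofReal_norm]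
    exact ENNReal.ofReal_le_ofReal (hy.le.trans (le_abs_self _))
  refine (measure_mono h1).trans_lt ((meas_ge_le_lintegral_div
    (hF.enorm.pow_const q).aemeasurable ?_ ?_).trans_lt ?_)
  · simp [hε]
  · exact ENNReal.rpow_ne_top_of_nonneg hq.le (by simp)
  · apply ENNReal.div_lt_top hN.ne
    simp [hε]

lemma DD_level (hq : 0 < q) (hK : ∀ g, MeasurePreserving (K g) ν ν) {F : Y → ℝ}
    (hF : Measurable F) (hN : NN ν q F < ⊤) (hc : CC ν q K F) {ε : ℝ} (hε : 0 < ε) :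
    DD ν q K {y | ε < F y} := by
  have hms : MeasurableSet {y | ε < F y} := measurableSet_lt measurable_const hF
  refine CC_approx hq hK (ind_meas hms) ?_
  intro δ hδ
  set ψ : ℕ → Y → ℝ := fun n y => min 1 (max 0 (n * (F y - ε))) with hψ
  have hψm : ∀ n, Measurable (ψ n) := fun n => by
    rw [hψ]; fun_prop
  have hψc : ∀ n, CC ν q K (ψ n) := by
    intro n
    refine CC_of_le hq hK n hc hc hF.aestronglyMeasurable ?_
    intro y y'
    simp only [hψ, Real.norm_eq_abs]
    have h0 : (0 : ℝ) ≤ n := by positivity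
    have e1 : |min 1 (max 0 ((n:ℝ) * (F y - ε))) - min 1 (max 0 (n * (F y' - ε)))| ≤
        |(n:ℝ) * (F y - ε) - n * (F y' - ε)| := by
      refine (abs_min_sub_min_le_max _ _ _ _).trans ?_
      rw [sub_self, abs_zero]
      refine max_le (abs_nonneg _) ((abs_max_sub_max_le_max _ _ _ _).trans ?_)
      rw [sub_self, abs_zero]
      exact max_le (abs_nonneg _) le_rfl
    refine e1.trans ?_
    rw [← mul_sub, abs_mul, abs_of_nonneg h0, sub_sub_sub_cancel_right]
    gcongr
    linarith [abs_nonneg (F y - F y')]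
  have hlim : Tendsto (fun n => NN ν q (fun y => ({y | ε < F y}.indicator (fun _ => (1 : ℝ))) y
      - ψ n y)) atTop (𝓝 (∫⁻ _, 0 ∂ν)) := by
    unfold NN
    refine tendsto_lintegral_of_dominated_convergence
      (bound := {y | ε < F y}.indicator 1) ?_ ?_ ?_ ?_
    · intro n
      exact ((((measurable_const.indicator hms).sub (hψm n))).enorm.pow_const q)
    · intro n
      filter_upwards with y
      by_cases a : ε < F y
      · rw [Set.indicator_of_mem (by exact a), Set.indicator_of_mem (by exact a)]
        have h1 : ‖1 - ψ n y‖ₑ ≤ 1 := by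
          rw [← ofReal_norm, ← ENNReal.ofReal_one]
          apply ENNReal.ofReal_le_ofReal
          rw [Real.norm_eq_abs, abs_le]
          have : ψ n y ≤ 1 := min_le_left _ _
          have : 0 ≤ ψ n y := le_min zero_le_one (le_max_left _ _)
          constructor <;> linarith
        exact ENNReal.rpow_le_one h1 hq.le
      · have : ψ n y = 0 := by
          simp only [hψ]
          rw [max_eq_left, min_eq_right zero_le_one]
          exact mul_nonpos_of_nonneg_of_nonpos (by positivity) (by linarith)
        rw [Set.indicator_of_notMem (by exact a), this]
        simp [hq]
    · rw [lintegral_indicator_one hms]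
      exact (level_fin hq hF hN hε).ne
    · filter_upwards with y
      apply tendsto_const_nhds.congr'
      by_cases a : ε < F y
      · obtain ⟨N, hN⟩ := exists_nat_gt (1 / (F y - ε))
        filter_upwards [eventually_ge_atTop N] with n hn
        have hn' : (N : ℝ) ≤ n := by exact_mod_cast hn
        have h1 : (1:ℝ) ≤ n * (F y - ε) := by
          rw [div_lt_iff₀ (by linarith)] at hN
          have := mul_le_mul_of_nonneg_right hn' (by linarith : 0 ≤ F y - ε)
          linarith
        have : ψ n y = 1 := by
          simp only [hψ]
          rw [min_eq_left]
          exact h1.trans (le_max_right _ _)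
        rw [Set.indicator_of_mem (by exact a), this]
        simp [hq]
      · filter_upwards with n
        have : ψ n y = 0 := by
          simp only [hψ]
          rw [max_eq_left, min_eq_right zero_le_one]
          exact mul_nonpos_of_nonneg_of_nonpos (by positivity) (by linarith)
        rw [Set.indicator_of_notMem (by exact a), this]
        simp [hq]
  rw [lintegral_zero] at hlim
  obtain ⟨n, hn⟩ := (ENNReal.tendsto_nhds_zero.1 hlim δ (pos_iff_ne_zero.2 hδ)).exists
  exact ⟨ψ n, (hψm n).aestronglyMeasurable, hψc n, hn⟩

/-- all sets whose trace on `C` is good form a sigma-algebra -/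
@[reducible] def goodSigma (hq : 0 < q) (hK : ∀ g, MeasurePreserving (K g) ν ν) (C : Set Y)
    (hC : MeasurableSet C) (hCf : ν C ≠ ⊤) (hCD : DD ν q K C) : MeasurableSpace Y where
  MeasurableSet' B := MeasurableSet B ∧ DD ν q K (B ∩ C)
  measurableSet_empty := ⟨MeasurableSet.empty, by simpa using DD_empty hq⟩
  measurableSet_compl B hB := ⟨hB.1.compl, by
    have : Bᶜ ∩ C = C \ (B ∩ C) := by ext y; simp; tauto
    rw [this]
    exact DD_diff hq hK hC hCD hB.2⟩
  measurableSet_iUnion B hB := ⟨MeasurableSet.iUnion fun n => (hB n).1, by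
    rw [Set.iUnion_inter]
    refine DD_iUnion hq hK (fun n => (hB n).1.inter hC) (fun n => (hB n).2) ?_
    refine measure_ne_top_of_subset ?_ hCf
    exact Set.iUnion_subset fun n => Set.inter_subset_right⟩

lemma DD_level_inter (hq : 0 < q) (hK : ∀ g, MeasurePreserving (K g) ν ν) {F : Y → ℝ}
    (hF : Measurable F) (hc : CC ν q K F) (C : Set Y)
    (hC : MeasurableSet C) (hCf : ν C ≠ ⊤) (hCD : DD ν q K C) (a : ℝ) :
    DD ν q K ({y | a < F y} ∩ C) := by
  set Ψ : Y → ℝ := C.indicator (fun y => min 1 (max 0 (F y - a))) with hΨ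
  have hΨm : Measurable Ψ := Measurable.indicator (by fun_prop) hC
  have hΨc : CC ν q K Ψ := by
    refine CC_of_le hq hK 1 hCD hc (ind_meas hC) ?_
    intro y y'
    have b1 : ∀ y, 0 ≤ min 1 (max 0 (F y - a)) ∧ min 1 (max 0 (F y - a)) ≤ 1 := fun y =>
      ⟨le_min zero_le_one (le_max_left _ _), min_le_left _ _⟩
    have e1 : |min 1 (max 0 (F y - a)) - min 1 (max 0 (F y' - a))| ≤
        |F y - F y'| := by
      refine (abs_min_sub_min_le_max _ _ _ _).trans ?_
      rw [sub_self, abs_zero]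
      refine max_le (abs_nonneg _) ((abs_max_sub_max_le_max _ _ _ _).trans ?_)
      rw [sub_self, abs_zero, sub_sub_sub_cancel_right]
      exact max_le (abs_nonneg _) le_rfl
    have b2 := b1 y
    have b3 := b1 y'
    have b4 := abs_nonneg (F y - F y')
    simp only [hΨ, Real.norm_eq_abs]
    by_cases h1 : y ∈ C <;> by_cases h2 : y' ∈ C
    · simp only [Set.indicator_of_mem h1, Set.indicator_of_mem h2]
      simpa using e1
    · simp only [Set.indicator_of_mem h1, Set.indicator_of_notMem h2]
      rw [abs_of_nonneg (by linarith [b2.1])]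
      simp
    · simp only [Set.indicator_of_notMem h1, Set.indicator_of_mem h2]
      rw [zero_sub, abs_neg, abs_of_nonneg (by linarith [b3.1])]
      simp
    · simp only [Set.indicator_of_notMem h1, Set.indicator_of_notMem h2]
      simp
  have hΨN : NN ν q Ψ < ⊤ := by
    refine lt_of_le_of_lt ?_ (lt_top_iff_ne_top.2 hCf)
    rw [← lintegral_indicator_one hC]
    apply lintegral_mono
    intro y
    by_cases h : y ∈ C
    · simp only [hΨ, Set.indicator_of_mem h]
      apply ENNReal.rpow_le_one _ hq.le
      rw [← ofReal_norm, ← ENNReal.ofReal_one]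
      apply ENNReal.ofReal_le_ofReal
      rw [Real.norm_of_nonneg (le_min zero_le_one (le_max_left _ _))]
      exact min_le_left _ _
    · simp [hΨ, h, hq]
  have hU : ({y | a < F y} ∩ C) = ⋃ n : ℕ, {y | 1 / ((n : ℝ) + 1) < Ψ y} := by
    ext y
    simp only [Set.mem_inter_iff, Set.mem_ofPred_eq, Set.mem_iUnion]
    constructor
    · rintro ⟨h1, h2⟩
      have : 0 < Ψ y := by
        simp only [hΨ, Set.indicator_of_mem h2]
        exact lt_min zero_lt_one (lt_max_of_lt_right (by linarith))
      exact exists_nat_one_div_lt this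
    · rintro ⟨n, hn⟩
      have h0 : 0 < Ψ y := lt_trans (by positivity) hn
      by_cases h : y ∈ C
      · refine ⟨?_, h⟩
        simp only [hΨ, Set.indicator_of_mem h] at h0
        have := lt_of_lt_of_le h0 (min_le_right _ _)
        rcases lt_max_iff.1 this with h | h
        · exact absurd h (lt_irrefl _)
        · linarith
      · simp [hΨ, h] at h0
  rw [hU]
  refine DD_iUnion hq hK (fun n => measurableSet_lt measurable_const hΨm)
    (fun n => DD_level hq hK hΨm hΨN hΨc (by positivity)) ?_
  rw [← hU]
  exact measure_ne_top_of_subset Set.inter_subset_right hCf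

lemma sigma_gen_aux {Y ι : Type*} (u : ι → Y → ℝ) (hinj : Function.Injective (fun y n => u n y))
    (m : MeasurableSpace Y) (h : ∀ n a, MeasurableSet[m] {y | a < u n y}) (B : Set Y)
    (hB : MeasurableSet ((fun y n => u n y) '' B)) : MeasurableSet[m] B := by
  have hum : ∀ n, Measurable (u n) := fun n => measurable_of_Ioi (fun a => h n a)
  have hJ : Measurable (fun y n => u n y) := measurable_pi_lambda _ hum
  have h1 := hJ hB
  rwa [hinj.preimage_image] at h1

lemma sigma_gen [StandardBorelSpace Y] {ι : Type*} [Countable ι] (u : ι → Y → ℝ)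
    (hu : ∀ n, Measurable (u n)) (hinj : Function.Injective (fun y n => u n y))
    (B : Set Y) (hB : MeasurableSet B) :
    ∀ (m : MeasurableSpace Y) (_ : ∀ n a, MeasurableSet[m] {y | a < u n y}), MeasurableSet[m] B := by
  have h2 := ((measurable_pi_lambda (fun y n => u n y) hu).measurableEmbedding
    hinj).measurableSet_image.2 hB
  intro m h
  exact sigma_gen_aux u hinj m h B h2

lemma DD_all [StandardBorelSpace Y] (hq : 0 < q) (hK : ∀ g, MeasurePreserving (K g) ν ν)
    {ι : Type*} [Countable ι] (u : ι → Y → ℝ) (hu : ∀ n, Measurable (u n))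
    (hinj : Function.Injective (fun y n => u n y)) (hcov : ∀ᵐ y ∂ν, ∃ n, u n y ≠ 0)
    (huN : ∀ n, NN ν q (u n) < ⊤) (huc : ∀ n, CC ν q K (u n)) (B : Set Y) (hB : MeasurableSet B)
    (hBf : ν B ≠ ⊤) : DD ν q K B := by
  have habs : ∀ n, CC ν q K (fun y => |u n y|) := by
    intro n
    refine CC_of_le hq hK 1 (huc n) (huc n) (hu n).aestronglyMeasurable ?_
    intro y y'
    rw [one_mul]
    refine (abs_abs_sub_abs_le_abs_sub _ _).trans ?_
    exact le_add_of_nonneg_right (norm_nonneg _)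
  have habsm : ∀ n, Measurable (fun y => |u n y|) := fun n => (hu n).abs
  have habsN : ∀ n, NN ν q (fun y => |u n y|) < ⊤ := by
    intro n
    simpa [NN] using huN n
  set C : ι × ℕ → Set Y := fun i => {y | 1 / ((i.2 : ℝ) + 1) < |u i.1 y|} with hCdef
  have hCm : ∀ i, MeasurableSet (C i) := fun i => measurableSet_lt measurable_const (habsm _)
  have hCf : ∀ i, ν (C i) ≠ ⊤ := fun i =>
    (level_fin hq (habsm _) (habsN _) (by positivity)).ne
  have hCD : ∀ i, DD ν q K (C i) := fun i =>
    DD_level hq hK (habsm _) (habsN _) (habs _) (by positivity)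
  have hBC : ∀ i, DD ν q K (B ∩ C i) := by
    intro i
    refine (sigma_gen u hu hinj B hB (goodSigma hq hK (C i) (hCm i) (hCf i) (hCD i)) ?_).2
    intro n a
    exact ⟨measurableSet_lt measurable_const (hu n),
        DD_level_inter hq hK (hu n) (huc n) _ (hCm i) (hCf i) (hCD i) a⟩
  have hae : (⋃ i, B ∩ C i) =ᵐ[ν] B := by
    rw [← Set.inter_iUnion]
    have : (⋃ i, C i) =ᵐ[ν] Set.univ := by
      rw [eventuallyEq_univ]
      filter_upwards [hcov] with y hy
      obtain ⟨n, hn⟩ := hy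
      obtain ⟨k, hk⟩ := exists_nat_one_div_lt (abs_pos.2 hn)
      exact Set.mem_iUnion.2 ⟨(n, k), hk⟩
    have h2 := (ae_eq_refl B).inter this
    rwa [Set.inter_univ] at h2
  refine DD_congr hK hae (DD_iUnion' hq hK (fun i => hB.inter (hCm i)) hBC ?_)
  rw [measure_congr hae]; exact hBf

lemma CC_all [StandardBorelSpace Y] (hq : 0 < q) (hK : ∀ g, MeasurePreserving (K g) ν ν)
    {ι : Type*} [Countable ι] (u : ι → Y → ℝ) (hu : ∀ n, Measurable (u n))
    (hinj : Function.Injective (fun y n => u n y)) (hcov : ∀ᵐ y ∂ν, ∃ n, u n y ≠ 0)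
    (huN : ∀ n, NN ν q (u n) < ⊤) (huc : ∀ n, CC ν q K (u n)) (F : Y → ℂ)
    (hF : MemLp F (ENNReal.ofReal q) ν) : CC ν q K F := by
  refine CC_approx hq hK hF.1 ?_
  intro ε hε
  have key : ∃ g : Y → ℂ, eLpNorm (F - g) (ENNReal.ofReal q) ν ≤ ε ^ (1 / q) ∧
      (AEStronglyMeasurable g ν ∧ CC ν q K g) := by
    refine MemLp.induction_dense (by simp)
      (fun F : Y → ℂ => AEStronglyMeasurable F ν ∧ CC ν q K F) ?_ ?_ (fun f hf => hf.1) hF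
      (by simp [hε, hq.le])
    · intro c s hs hsf δ hδ
      refine ⟨s.indicator fun _ => c, by simp, (stronglyMeasurable_const.indicator hs).aestronglyMeasurable, ?_⟩
      have hD := DD_all hq hK u hu hinj hcov huN huc s hs hsf.ne
      refine CC_of_le hq hK ‖c‖ hD hD (ind_meas hs) ?_
      intro y y'
      have h0 := norm_nonneg c
      by_cases a : y ∈ s <;> by_cases b : y' ∈ s <;> simp [a, b] <;> linarith
    · rintro f g ⟨hf1, hf2⟩ ⟨hg1, hg2⟩
      refine ⟨hf1.add hg1, CC_of_le hq hK 1 hf2 hg2 hf1 ?_⟩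
      intro y y'
      rw [one_mul, Pi.add_apply, Pi.add_apply, add_sub_add_comm]
      exact norm_add_le _ _
  obtain ⟨g, hg, hg1, hg2⟩ := key
  refine ⟨g, hg1, hg2, ?_⟩
  rw [eLpNorm_eq_NN hq] at hg
  rwa [ENNReal.rpow_le_rpow_iff (by positivity)] at hg

end Cont

theorem framework {G : Type*} [Group G] [TopologicalSpace G] {Y : Type} [MeasurableSpace Y]
    [StandardBorelSpace Y] (ν : Measure Y) {q : ℝ} (hq : 0 < q)
    {I : Type*} (α : G → I → I) (h_one : ∀ i, α 1 i = i) (h_mul : ∀ g h i, α (g * h) i = α g (α h i))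
    (K : G → Y → Y) (hK : ∀ g, MeasurePreserving (K g) ν ν)
    (D : I → I → Y → ℝ) (hDm : ∀ i j, AEStronglyMeasurable (D i j) ν)
    (hDN : ∀ i j, NN ν q (D i j) < ⊤)
    (hchain : ∀ i j k, D i k =ᵐ[ν] fun y => D i j y + D j k y)
    (hDK : ∀ g i j, (fun y => D i j (K g y)) =ᵐ[ν] D (α g i) (α g j))
    (hcont : ∀ i g₀, Tendsto (fun g => NN ν q (D (α g i) (α g₀ i))) (𝓝 g₀) (𝓝 0))
    (i₀ : I) (hunb : ¬ ∃ C : ℝ≥0∞, C ≠ ⊤ ∧ ∀ g, NN ν q (D (α g i₀) i₀) ≤ C)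
    {ι : Type*} [Countable ι] (s : ι → I) (u : ι → Y → ℝ) (hu : ∀ n, Measurable (u n))
    (hus : ∀ n, u n =ᵐ[ν] D (s n) i₀) (hinj : Function.Injective (fun y n => u n y))
    (hcov : ∀ᵐ y ∂ν, ∃ n, u n y ≠ 0) :
    ∃ β : AffineIsometricAction G ν q, β.HasUnboundedOrbit := by
  -- basic consequences
  have hii : ∀ i, D i i =ᵐ[ν] 0 := by
    intro i
    filter_upwards [hchain i i i] with y hy
    simpa using hy
  have hanti : ∀ i j, D i j =ᵐ[ν] fun y => - D j i y := by
    intro i j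
    filter_upwards [hchain i j i, hii i] with y hy h2
    rw [h2] at hy
    simp only [Pi.zero_apply] at hy
    linarith
  have huK : ∀ g n, (fun y => u n (K g y)) =ᵐ[ν] D (α g (s n)) (α g i₀) := fun g n =>
    ((hK g).quasiMeasurePreserving.ae_eq_comp (hus n)).trans (hDK g _ _)
  have hK1 : K 1 =ᵐ[ν] id := by
    have : ∀ᵐ y ∂ν, ∀ n, u n (K 1 y) = u n y := by
      rw [ae_all_iff]
      intro n
      filter_upwards [huK 1 n, hus n] with y h1 h2
      rw [h1, h2, h_one, h_one]
    filter_upwards [this] with y hy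
    exact hinj (funext hy)
  have hKmul : ∀ g h, K (g * h) =ᵐ[ν] fun y => K h (K g y) := by
    intro g h
    have : ∀ᵐ y ∂ν, ∀ n, u n (K (g * h) y) = u n (K h (K g y)) := by
      rw [ae_all_iff]
      intro n
      filter_upwards [huK (g * h) n, (hK g).quasiMeasurePreserving.ae_eq_comp (huK h n),
        hDK g (α h (s n)) (α h i₀)] with y h1 h2 h3
      simp only [Function.comp] at h2
      rw [h1, h2, h3, h_mul, h_mul]
    filter_upwards [this] with y hy
    exact hinj (funext hy)
  have huN : ∀ n, NN ν q (u n) < ⊤ := fun n => by rw [NN_congr (hus n)]; exact hDN _ _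
  have huc : ∀ n, CC ν q K (u n) := by
    intro n g₀
    have key : ∀ g, NN ν q (fun y => u n (K g y) - u n (K g₀ y)) ≤
        2 ^ q * (NN ν q (D (α g (s n)) (α g₀ (s n))) + NN ν q (D (α g i₀) (α g₀ i₀))) := by
      intro g
      refine NN_le_add hq (hDm _ _) ?_
      filter_upwards [huK g n, huK g₀ n, hchain (α g (s n)) (α g₀ (s n)) (α g i₀),
        hchain (α g₀ (s n)) (α g₀ i₀) (α g i₀), hanti (α g i₀) (α g₀ i₀)] with y h1 h2 h3 h4 h5
      rw [h1, h2, h3, h4]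
      have : D (α g (s n)) (α g₀ (s n)) y + (D (α g₀ (s n)) (α g₀ i₀) y + D (α g₀ i₀) (α g i₀) y) -
        D (α g₀ (s n)) (α g₀ i₀) y = D (α g (s n)) (α g₀ (s n)) y - D (α g i₀) (α g₀ i₀) y := by
        rw [h5]; ring
      rw [this]
      exact norm_sub_le _ _
    refine tendsto_of_tendsto_of_tendsto_of_le_of_le tendsto_const_nhds ?_ (fun _ => zero_le) key
    have : (0 : ℝ≥0∞) = 2 ^ q * (0 + 0) := by simp
    rw [this]
    refine ENNReal.Tendsto.const_mul ((hcont _ g₀).add (hcont _ g₀)) ?_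
    right; exact ENNReal.rpow_ne_top_of_nonneg hq.le (by simp)
  -- the cocycle
  set b : G → Y → ℂ := fun g y => (D (α g i₀) i₀ y : ℂ) with hb
  have hbm : ∀ g, MemLp (b g) (ENNReal.ofReal q) ν := by
    intro g
    rw [memLp_iff_NN hq]
    refine ⟨Complex.continuous_ofReal.comp_aestronglyMeasurable (hDm _ _), ?_⟩
    have : NN ν q (b g) = NN ν q (D (α g i₀) i₀) := by
      unfold NN; congr 1; ext y
      rw [← ofReal_norm, ← ofReal_norm, hb, Complex.norm_real]
    rw [this]; exact hDN _ _
  have hcoc : ∀ g h, b (g * h) =ᵐ[ν] fun y => b h (K g y) + b g y := by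
    intro g h
    filter_upwards [hDK g (α h i₀) i₀, hchain (α g (α h i₀)) (α g i₀) i₀] with y h1 h2
    simp only [hb]
    rw [h_mul, h1, h2]
    push_cast; ring
  let act : G → Lp ℂ (ENNReal.ofReal q) ν → Lp ℂ (ENNReal.ofReal q) ν := fun g F =>
    Lp.compMeasurePreservingₗ ℝ (K g) (hK g) F + (hbm g).toLp
  have hact : ∀ g F, (act g F : Y → ℂ) =ᵐ[ν] fun y => F (K g y) + b g y := by
    intro g F
    filter_upwards [Lp.coeFn_add (Lp.compMeasurePreservingₗ ℝ (K g) (hK g) F) (hbm g).toLp,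
      Lp.coeFn_compMeasurePreserving F (hK g), (hbm g).coeFn_toLp] with y h1 h2 h3
    rw [h1, Pi.add_apply, h3]
    congr 1
  have hactsub : ∀ g F F', act g F - act g F' = Lp.compMeasurePreservingₗ ℝ (K g) (hK g) (F - F') := by
    intro g F F'
    simp only [act]
    rw [map_sub]; abel
  let β : AffineIsometricAction G ν q := 
    { act := act
      act_one := by
        intro F
        apply Lp.ext
        have hb1 : b 1 =ᵐ[ν] 0 := by
          filter_upwards [hii i₀] with y hy
          simp only [hb, h_one, hy]; simp
        filter_upwards [hact 1 F, hb1, hK1] with y h1 h2 h3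
        rw [h1, h2, h3]; simp
      act_mul := by
        intro g h F
        apply Lp.ext
        filter_upwards [hact (g * h) F, hact g (act h F),
          (hK g).quasiMeasurePreserving.ae_eq_comp (hact h F), hcoc g h, hKmul g h]
          with y h1 h2 h3 h4 h5
        simp only [Function.comp] at h3
        rw [h1, h2, h3, h4, h5, add_assoc]
      isometry := by
        intro g F F'
        rw [← AddSubgroupClass.coe_sub, ← AddSubgroupClass.coe_sub, hactsub, pPow_eq_NN, pPow_eq_NN,
          ← NN_comp (hK g) (Lp.aestronglyMeasurable (F - F'))]
        exact NN_congr (Lp.coeFn_compMeasurePreserving (F - F') (hK g))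
      affine := by
        intro g t F F'
        simp only [act]
        rw [map_add, map_smul, map_smul, smul_add, smul_add, sub_smul (1 : ℝ) t (MemLp.toLp _ _), one_smul]
        abel
      continuous := by
        intro F g₀
        have hCC := CC_all hq hK u hu hinj hcov huN huc F (Lp.memLp F) g₀
        have key : ∀ g, pPow ν q ((act g F : Y →ₘ[ν] ℂ) - (act g₀ F : Y →ₘ[ν] ℂ)) ≤
            2 ^ q * (NN ν q (fun y => F (K g y) - F (K g₀ y)) + NN ν q (D (α g i₀) (α g₀ i₀))) := by
          intro g
          rw [← AddSubgroupClass.coe_sub, pPow_eq_NN]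
          refine NN_le_add hq ?_ ?_
          · exact ((Lp.aestronglyMeasurable F).comp_measurePreserving (hK g)).sub
              ((Lp.aestronglyMeasurable F).comp_measurePreserving (hK g₀))
          · filter_upwards [Lp.coeFn_sub (act g F) (act g₀ F), hact g F, hact g₀ F,
              hchain (α g i₀) (α g₀ i₀) i₀] with y h1 h2 h3 h4
            rw [h1, Pi.sub_apply, h2, h3]
            simp only [hb]
            rw [h4, ← Complex.norm_real (D (α g i₀) (α g₀ i₀) y)]
            refine le_trans (le_of_eq ?_) (norm_add_le _ _)
            congr 1; push_cast; ring
        refine tendsto_of_tendsto_of_tendsto_of_le_of_le tendsto_const_nhds ?_ (fun _ => zero_le) key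
        have : (0 : ℝ≥0∞) = 2 ^ q * (0 + 0) := by simp
        rw [this]
        refine ENNReal.Tendsto.const_mul (hCC.add (hcont _ g₀)) ?_
        right; exact ENNReal.rpow_ne_top_of_nonneg hq.le (by simp) }
  refine ⟨β, 0, ?_⟩
  rintro ⟨C, hC, hCb⟩
  refine hunb ⟨C, hC, fun g => ?_⟩
  refine le_trans (le_of_eq ?_) (hCb g)
  rw [pPow_eq_NN]
  have h1 : ((β.act g 0 : Lp ℂ (ENNReal.ofReal q) ν) : Y → ℂ) =ᵐ[ν] b g := by
    filter_upwards [hact g 0, (hK g).quasiMeasurePreserving.ae_eq_comp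
      (Lp.coeFn_zero ℂ (ENNReal.ofReal q) ν)] with y h1 h2
    simp only [Function.comp] at h2
    refine h1.trans ?_
    rw [h2]; simp
  rw [NN_congr h1]
  unfold NN; congr 1; ext y
  rw [← ofReal_norm, ← ofReal_norm, hb, Complex.norm_real]

/-! ### Lamperti's theorem -/

lemma rpow_superadd {A B s : ℝ} (hA : 0 < A) (hB : 0 < B) (hs : 1 < s) :
    A ^ s + B ^ s < (A + B) ^ s := by
  have h1 : A ^ (s - 1) < (A + B) ^ (s - 1) := Real.rpow_lt_rpow hA.le (by linarith) (by linarith)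
  have h2 : B ^ (s - 1) < (A + B) ^ (s - 1) := Real.rpow_lt_rpow hB.le (by linarith) (by linarith)
  have e : ∀ x : ℝ, 0 < x → x ^ s = x * x ^ (s - 1) := by
    intro x hx
    rw [Real.rpow_sub_one hx.ne']; field_simp
  rw [e A hA, e B hB, e (A + B) (by positivity)]
  nlinarith

lemma rpow_subadd {A B s : ℝ} (hA : 0 < A) (hB : 0 < B) (hs : s < 1) :
    (A + B) ^ s < A ^ s + B ^ s := by
  have h1 : (A + B) ^ (s - 1) < A ^ (s - 1) :=
    Real.rpow_lt_rpow_of_neg hA (by linarith) (by linarith)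
  have h2 : (A + B) ^ (s - 1) < B ^ (s - 1) :=
    Real.rpow_lt_rpow_of_neg hB (by linarith) (by linarith)
  have e : ∀ x : ℝ, 0 < x → x ^ s = x * x ^ (s - 1) := by
    intro x hx
    rw [Real.rpow_sub_one hx.ne']; field_simp
  rw [e A hA, e B hB, e (A + B) (by positivity)]
  nlinarith

lemma norm_rpow_sq {p : ℝ} (z : ℂ) : ‖z‖ ^ p = (‖z‖ ^ 2) ^ (p / 2) := by
  rw [← Real.rpow_natCast, ← Real.rpow_mul (norm_nonneg _)]
  congr 1; push_cast; ring

lemma clarkson {p : ℝ} (hp : 0 < p) {z w : ℂ} (hz : z ≠ 0) (hw : w ≠ 0) :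
    (2 < p → 2 * (‖z‖ ^ p + ‖w‖ ^ p) < ‖z + w‖ ^ p + ‖z - w‖ ^ p) ∧
    (p < 2 → ‖z + w‖ ^ p + ‖z - w‖ ^ p < 2 * (‖z‖ ^ p + ‖w‖ ^ p)) := by
  have hpar := parallelogram_law_with_norm ℝ z w
  have hA : 0 < ‖z‖ ^ 2 := by positivity
  have hB : 0 < ‖w‖ ^ 2 := by positivity
  rw [norm_rpow_sq z, norm_rpow_sq w, norm_rpow_sq (z + w), norm_rpow_sq (z - w)]
  have ha : 0 ≤ ‖z + w‖ ^ 2 := by positivity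
  have hb : 0 ≤ ‖z - w‖ ^ 2 := by positivity
  have hmid : (1 / 2 : ℝ) * ‖z + w‖ ^ 2 + (1 / 2 : ℝ) * ‖z - w‖ ^ 2 = ‖z‖ ^ 2 + ‖w‖ ^ 2 := by
    nlinarith
  constructor
  · intro h
    have h1 := rpow_superadd hA hB (s := p / 2) (by linarith)
    have h2 := (convexOn_rpow (p := p / 2) (by linarith)).2 (Set.mem_Ici.2 ha) (Set.mem_Ici.2 hb)
      (by norm_num : (0 : ℝ) ≤ 1 / 2) (by norm_num : (0 : ℝ) ≤ 1 / 2) (by norm_num)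
    simp only [smul_eq_mul] at h2
    rw [hmid] at h2
    linarith
  · intro h
    have h1 := rpow_subadd hA hB (s := p / 2) (by linarith)
    have h2 := (Real.concaveOn_rpow (p := p / 2) (by linarith) (by linarith)).2 (Set.mem_Ici.2 ha)
      (Set.mem_Ici.2 hb)
      (by norm_num : (0 : ℝ) ≤ 1 / 2) (by norm_num : (0 : ℝ) ≤ 1 / 2) (by norm_num)
    simp only [smul_eq_mul] at h2
    rw [hmid] at h2
    linarith

lemma enorm_rpow_ofReal {p : ℝ} (hp : 0 < p) (z : ℂ) : ‖z‖ₑ ^ p = ENNReal.ofReal (‖z‖ ^ p) := by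
  rw [← ofReal_norm, ENNReal.ofReal_rpow_of_nonneg (norm_nonneg _) hp.le]

lemma clarkson_enn {p : ℝ} (hp : 0 < p) (z w : ℂ) :
    (2 < p → 2 * (‖z‖ₑ ^ p + ‖w‖ₑ ^ p) ≤ ‖z + w‖ₑ ^ p + ‖z - w‖ₑ ^ p) ∧
    (p < 2 → ‖z + w‖ₑ ^ p + ‖z - w‖ₑ ^ p ≤ 2 * (‖z‖ₑ ^ p + ‖w‖ₑ ^ p)) ∧
    ((z = 0 ∨ w = 0) → ‖z + w‖ₑ ^ p + ‖z - w‖ₑ ^ p = 2 * (‖z‖ₑ ^ p + ‖w‖ₑ ^ p)) ∧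
    (p ≠ 2 → ‖z + w‖ₑ ^ p + ‖z - w‖ₑ ^ p = 2 * (‖z‖ₑ ^ p + ‖w‖ₑ ^ p) → z = 0 ∨ w = 0) := by
  have hz : (z = 0 ∨ w = 0) → ‖z + w‖ₑ ^ p + ‖z - w‖ₑ ^ p = 2 * (‖z‖ₑ ^ p + ‖w‖ₑ ^ p) := by
    rintro (rfl | rfl)
    · simp [hp, two_mul]
    · simp [hp, two_mul]
  by_cases h : z = 0 ∨ w = 0
  · refine ⟨fun _ => (hz h).ge, fun _ => (hz h).le, hz, fun _ _ => h⟩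
  · push Not at h
    have hc := clarkson hp h.1 h.2
    have e1 : ‖z + w‖ₑ ^ p + ‖z - w‖ₑ ^ p = ENNReal.ofReal (‖z + w‖ ^ p + ‖z - w‖ ^ p) := by
      rw [ENNReal.ofReal_add (by positivity) (by positivity), enorm_rpow_ofReal hp,
        enorm_rpow_ofReal hp]
    have e2 : 2 * (‖z‖ₑ ^ p + ‖w‖ₑ ^ p) = ENNReal.ofReal (2 * (‖z‖ ^ p + ‖w‖ ^ p)) := by
      rw [ENNReal.ofReal_mul (by norm_num), ENNReal.ofReal_add (by positivity) (by positivity),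
        enorm_rpow_ofReal hp, enorm_rpow_ofReal hp]
      simp
    rw [e1, e2]
    refine ⟨fun h2 => ENNReal.ofReal_le_ofReal (hc.1 h2).le,
      fun h2 => ENNReal.ofReal_le_ofReal (hc.2 h2).le, fun h' => ?_, fun h2 h3 => ?_⟩
    · rcases h' with h' | h'
      · exact absurd h' h.1
      · exact absurd h' h.2
    · exfalso
      rw [ENNReal.ofReal_eq_ofReal_iff (by positivity) (by positivity)] at h3
      rcases lt_or_gt_of_ne h2 with h4 | h4
      · exact absurd h3 (hc.2 h4).ne
      · exact absurd h3 (hc.1 h4).ne'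

/-- almost everywhere disjoint functions -/
def Disj {X : Type*} [MeasurableSpace X] (μ : Measure X) (f h : X → ℂ) : Prop :=
  ∀ᵐ x ∂μ, f x = 0 ∨ h x = 0

lemma disj_iff {X : Type*} [MeasurableSpace X] {μ : Measure X} {p : ℝ} (hp : 0 < p) (hp2 : p ≠ 2)
    {f h : X → ℂ} (hf : MemLp f (ENNReal.ofReal p) μ) (hh : MemLp h (ENNReal.ofReal p) μ) :
    Disj μ f h ↔ NN μ p (fun x => f x + h x) + NN μ p (fun x => f x - h x) =
      2 * (NN μ p f + NN μ p h) := by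
  have hfN := ((memLp_iff_NN hp).1 hf).2
  have hhN := ((memLp_iff_NN hp).1 hh).2
  have m1 : AEMeasurable (fun x => ‖f x + h x‖ₑ ^ p) μ := (hf.1.add hh.1).enorm.pow_const p
  have m2 : AEMeasurable (fun x => ‖f x - h x‖ₑ ^ p) μ := (hf.1.sub hh.1).enorm.pow_const p
  have m3 : AEMeasurable (fun x => ‖f x‖ₑ ^ p) μ := hf.1.enorm.pow_const p
  have m4 : AEMeasurable (fun x => ‖h x‖ₑ ^ p) μ := hh.1.enorm.pow_const p
  have e1 : NN μ p (fun x => f x + h x) + NN μ p (fun x => f x - h x) =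
      ∫⁻ x, (‖f x + h x‖ₑ ^ p + ‖f x - h x‖ₑ ^ p) ∂μ := (lintegral_add_left' m1 _).symm
  have e2 : 2 * (NN μ p f + NN μ p h) = ∫⁻ x, 2 * (‖f x‖ₑ ^ p + ‖h x‖ₑ ^ p) ∂μ := by
    rw [lintegral_const_mul' _ _ (by simp), lintegral_add_left' m3]; rfl
  have hfin : ∫⁻ x, 2 * (‖f x‖ₑ ^ p + ‖h x‖ₑ ^ p) ∂μ ≠ ⊤ := by
    rw [← e2]; finiteness
  rw [e1, e2]
  constructor
  · intro hd
    apply lintegral_congr_ae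
    filter_upwards [hd] with x hx
    exact (clarkson_enn hp _ _).2.2.1 hx
  · intro heq
    rcases lt_or_gt_of_ne hp2 with h2 | h2
    · have := ae_eq_of_ae_le_of_lintegral_le (μ := μ)
        (f := fun x => ‖f x + h x‖ₑ ^ p + ‖f x - h x‖ₑ ^ p)
        (g := fun x => 2 * (‖f x‖ₑ ^ p + ‖h x‖ₑ ^ p))
        (Eventually.of_forall fun x => (clarkson_enn hp _ _).2.1 h2) (by rw [heq]; exact hfin)
        ((m3.add m4).const_mul 2) heq.ge
      filter_upwards [this] with x hx
      exact (clarkson_enn hp _ _).2.2.2 hp2 hx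
    · have := ae_eq_of_ae_le_of_lintegral_le (μ := μ)
        (g := fun x => ‖f x + h x‖ₑ ^ p + ‖f x - h x‖ₑ ^ p)
        (f := fun x => 2 * (‖f x‖ₑ ^ p + ‖h x‖ₑ ^ p))
        (Eventually.of_forall fun x => (clarkson_enn hp _ _).1 h2) hfin
        (m1.add m2) heq.le
      filter_upwards [this] with x hx
      exact (clarkson_enn hp _ _).2.2.2 hp2 hx.symm

/-- A surjective real-linear isometry of `L_p`, seen at the level of functions. -/
structure LpIsom {X : Type*} [MeasurableSpace X] (μ : Measure X) (p : ℝ)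
    (T : (X → ℂ) → X → ℂ) : Prop where
  mem : ∀ f, MemLp f (ENNReal.ofReal p) μ → MemLp (T f) (ENNReal.ofReal p) μ
  meas : ∀ f, MemLp f (ENNReal.ofReal p) μ → Measurable (T f)
  congr : ∀ f g, MemLp f (ENNReal.ofReal p) μ → f =ᵐ[μ] g → T f =ᵐ[μ] T g
  add : ∀ f g, MemLp f (ENNReal.ofReal p) μ → MemLp g (ENNReal.ofReal p) μ →
    T (fun x => f x + g x) =ᵐ[μ] fun x => T f x + T g x
  sub : ∀ f g, MemLp f (ENNReal.ofReal p) μ → MemLp g (ENNReal.ofReal p) μ →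
    T (fun x => f x - g x) =ᵐ[μ] fun x => T f x - T g x
  norm : ∀ f, MemLp f (ENNReal.ofReal p) μ → NN μ p (T f) = NN μ p f
  surj : ∀ k, MemLp k (ENNReal.ofReal p) μ → ∃ f, MemLp f (ENNReal.ofReal p) μ ∧ T f =ᵐ[μ] k

section Lamperti

variable {X : Type*} [MeasurableSpace X] {μ : Measure X} {p : ℝ} {T : (X → ℂ) → X → ℂ}

lemma LpIsom.disj (hT : LpIsom μ p T) (hp : 0 < p) (hp2 : p ≠ 2)
    {f h : X → ℂ} (hf : MemLp f (ENNReal.ofReal p) μ) (hh : MemLp h (ENNReal.ofReal p) μ) :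
    Disj μ (T f) (T h) ↔ Disj μ f h := by
  rw [disj_iff hp hp2 hf hh, disj_iff hp hp2 (hT.mem f hf) (hT.mem h hh),
    hT.norm f hf, hT.norm h hh, ← NN_congr (hT.add f h hf hh), ← NN_congr (hT.sub f h hf hh),
    hT.norm (fun x => f x + h x) (hf.add hh), hT.norm (fun x => f x - h x) (hf.sub hh)]

lemma LpIsom.zero (hT : LpIsom μ p T) (hp : 0 < p) {f : X → ℂ}
    (hf : MemLp f (ENNReal.ofReal p) μ) : T f =ᵐ[μ] 0 ↔ f =ᵐ[μ] 0 := by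
  rw [← NN_eq_zero_iff hp (hT.mem f hf).1, ← NN_eq_zero_iff hp hf.1, hT.norm f hf]

end Lamperti


section Lamperti2

variable {X : Type*} [MeasurableSpace X] {μ : Measure X} {p : ℝ} {T : (X → ℂ) → X → ℂ}
  {H : X → ℂ}

lemma LpIsom.ind_add (hT : LpIsom μ p T) {f : X → ℂ} (hf : MemLp f (ENNReal.ofReal p) μ)
    {A : Set X} (hA : MeasurableSet A) :
    ∀ᵐ x ∂μ, T f x = T (A.indicator f) x + T (Aᶜ.indicator f) x := by
  have h := hT.add _ _ (hf.indicator hA) (hf.indicator hA.compl)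
  have e : (fun x => A.indicator f x + Aᶜ.indicator f x) = f := by
    ext x; exact congrFun (Set.indicator_self_add_compl A f) x
  rw [e] at h
  exact h

lemma LpIsom.ne_zero (hT : LpIsom μ p T) (hp : 0 < p) (hp2 : p ≠ 2)
    (hH : MemLp H (ENNReal.ofReal p) μ) (hH0 : ∀ x, H x ≠ 0) :
    ∀ᵐ x ∂μ, T H x ≠ 0 := by
  have hN : MeasurableSet {x | T H x = 0} :=
    measurableSet_eq_fun (hT.meas H hH) measurable_const
  obtain ⟨f, hf, hTf⟩ := hT.surj _ (hH.indicator hN)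
  have hd : Disj μ (T f) (T H) := by
    filter_upwards [hTf] with x hx
    rw [hx]
    by_cases h : T H x = 0
    · right; exact h
    · left; exact Set.indicator_of_notMem (s := {x | T H x = 0}) h H
  rw [hT.disj hp hp2 hf hH] at hd
  have hf0 : f =ᵐ[μ] 0 := by
    filter_upwards [hd] with x hx
    exact hx.resolve_right (hH0 x)
  have := (hT.zero hp hf).2 hf0
  filter_upwards [hTf, this] with x h1 h2 h3
  rw [h1] at h2
  rw [Set.indicator_of_mem (show x ∈ {x | T H x = 0} from h3)] at h2
  exact hH0 x h2

/-- image of a set under the Boolean isomorphism attached to `T` -/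
def SS (T : (X → ℂ) → X → ℂ) (H : X → ℂ) (A : Set X) : Set X := {x | T (A.indicator H) x ≠ 0}

lemma SS_meas (hT : LpIsom μ p T) (hH : MemLp H (ENNReal.ofReal p) μ) {A : Set X}
    (hA : MeasurableSet A) : MeasurableSet (SS T H A) :=
  (measurableSet_eq_fun (hT.meas _ (hH.indicator hA)) measurable_const).compl

lemma SS_disj (hT : LpIsom μ p T) (hp : 0 < p) (hp2 : p ≠ 2)
    {f : X → ℂ} (hf : MemLp f (ENNReal.ofReal p) μ)
    (hH : MemLp H (ENNReal.ofReal p) μ) {A : Set X}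
    (hA : MeasurableSet A) (hfA : ∀ᵐ x ∂μ, x ∈ A → f x = 0) :
    ∀ᵐ x ∂μ, x ∈ SS T H A → T f x = 0 := by
  have hd : Disj μ f (A.indicator H) := by
    filter_upwards [hfA] with x hx
    by_cases h : x ∈ A
    · exact Or.inl (hx h)
    · exact Or.inr (Set.indicator_of_notMem h _)
  rw [← hT.disj hp hp2 hf (hH.indicator hA)] at hd
  filter_upwards [hd] with x hx hxA
  exact hx.resolve_right hxA

lemma SS_disj' (hT : LpIsom μ p T) (hp : 0 < p) (hp2 : p ≠ 2)
    {f : X → ℂ} (hf : MemLp f (ENNReal.ofReal p) μ)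
    (hH : MemLp H (ENNReal.ofReal p) μ) (hH0 : ∀ x, H x ≠ 0) {A : Set X}
    (hA : MeasurableSet A) (h : ∀ᵐ x ∂μ, x ∈ SS T H A → T f x = 0) :
    ∀ᵐ x ∂μ, x ∈ A → f x = 0 := by
  have hd : Disj μ (T f) (T (A.indicator H)) := by
    filter_upwards [h] with x hx
    by_cases h : x ∈ SS T H A
    · exact Or.inl (hx h)
    · right
      by_contra h3
      exact h h3
  rw [hT.disj hp hp2 hf (hH.indicator hA)] at hd
  filter_upwards [hd] with x hx hxA
  rw [Set.indicator_of_mem hxA] at hx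
  exact hx.resolve_right (hH0 x)

lemma SS_compl (hT : LpIsom μ p T) (hp : 0 < p) (hp2 : p ≠ 2)
    (hH : MemLp H (ENNReal.ofReal p) μ) (hH0 : ∀ x, H x ≠ 0) {A : Set X}
    (hA : MeasurableSet A) : ∀ᵐ x ∂μ, x ∈ SS T H Aᶜ ↔ x ∉ SS T H A := by
  have h1 := SS_disj hT hp hp2 (hH.indicator hA.compl) hH hA
    (Eventually.of_forall fun x hx => Set.indicator_of_notMem (by simpa using hx) _)
  filter_upwards [hT.ne_zero hp hp2 hH hH0, hT.ind_add hH hA, h1] with x h2 h3 h4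
  constructor
  · intro h5 h6
    exact h5 (h4 h6)
  · intro h5 h6
    have h7 : T (A.indicator H) x = 0 := by
      by_contra h; exact h5 h
    rw [h6, h7] at h3
    exact h2 (by simpa using h3)

lemma SS_mono (hT : LpIsom μ p T) (hp : 0 < p) (hp2 : p ≠ 2)
    (hH : MemLp H (ENNReal.ofReal p) μ) (hH0 : ∀ x, H x ≠ 0) {A B : Set X}
    (hA : MeasurableSet A) (hB : MeasurableSet B) (hAB : A ⊆ B) :
    ∀ᵐ x ∂μ, x ∈ SS T H A → x ∈ SS T H B := by
  have h1 := SS_disj hT hp hp2 (hH.indicator hA) hH hB.compl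
    (Eventually.of_forall fun x hx => Set.indicator_of_notMem (fun h => hx (hAB h)) _)
  filter_upwards [SS_compl hT hp hp2 hH hH0 hB, h1] with x h2 h3 h4
  by_contra h5
  exact h4 (h3 (h2.2 h5))

lemma SS_iUnion (hT : LpIsom μ p T) (hp : 0 < p) (hp2 : p ≠ 2)
    (hH : MemLp H (ENNReal.ofReal p) μ) (hH0 : ∀ x, H x ≠ 0) {A : ℕ → Set X}
    (hA : ∀ n, MeasurableSet (A n)) :
    ∀ᵐ x ∂μ, x ∈ SS T H (⋃ n, A n) ↔ ∃ n, x ∈ SS T H (A n) := by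
  have hU : MeasurableSet (⋃ n, A n) := MeasurableSet.iUnion hA
  set E : Set X := SS T H (⋃ n, A n) \ ⋃ n, SS T H (A n) with hE
  have hEm : MeasurableSet E :=
    (SS_meas hT hH hU).diff (MeasurableSet.iUnion fun n => SS_meas hT hH (hA n))
  obtain ⟨f, hf, hTf⟩ := hT.surj _ ((hT.mem H hH).indicator hEm)
  have f1 : ∀ n, ∀ᵐ x ∂μ, x ∈ A n → f x = 0 := by
    intro n
    apply SS_disj' hT hp hp2 hf hH hH0 (hA n)
    filter_upwards [hTf] with x hx hxA
    rw [hx]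
    apply Set.indicator_of_notMem
    intro h
    exact h.2 (Set.mem_iUnion.2 ⟨n, hxA⟩)
  have f2 : ∀ᵐ x ∂μ, x ∈ (⋃ n, A n)ᶜ → f x = 0 := by
    apply SS_disj' hT hp hp2 hf hH hH0 hU.compl
    filter_upwards [hTf, SS_compl hT hp hp2 hH hH0 hU] with x hx hc hxA
    rw [hx]
    apply Set.indicator_of_notMem
    intro h
    exact hc.1 hxA h.1
  have f0 : f =ᵐ[μ] 0 := by
    filter_upwards [ae_all_iff.2 f1, f2] with x h1 h2
    by_cases h : x ∈ ⋃ n, A n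
    · obtain ⟨n, hn⟩ := Set.mem_iUnion.1 h
      exact h1 n hn
    · exact h2 h
  have f3 := (hT.zero hp hf).2 f0
  filter_upwards [hTf, f3, hT.ne_zero hp hp2 hH hH0,
    ae_all_iff.2 fun n => SS_mono hT hp hp2 hH hH0 (hA n) hU (Set.subset_iUnion A n)]
    with x h1 h2 h3 h4
  constructor
  · intro h5
    by_contra h6
    have : x ∈ E := ⟨h5, by simpa using h6⟩
    rw [h1, Set.indicator_of_mem this] at h2
    exact h3 h2
  · rintro ⟨n, hn⟩
    exact h4 n hn

/-- the set-theoretic transformation realising the Boolean isomorphism -/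
lemma exists_sigma [StandardBorelSpace X] [Nonempty X] (hT : LpIsom μ p T) (hp : 0 < p)
    (hp2 : p ≠ 2)
    (hH : MemLp H (ENNReal.ofReal p) μ) (hH0 : ∀ x, H x ≠ 0) :
    ∃ σ : X → X, Measurable σ ∧ ∀ A, MeasurableSet A → ∀ᵐ x ∂μ, σ x ∈ A ↔ x ∈ SS T H A := by
  classical
  obtain ⟨θ, hθ, hθi⟩ := MeasurableSpace.measurable_injection_nat_bool_of_countablySeparated X
  have hθn : ∀ n, MeasurableSet {x | θ x n = true} := fun n =>
    (measurable_pi_apply n).comp hθ (measurableSet_singleton true)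
  let τ : X → ℕ → Bool := fun x n => decide (x ∈ SS T H {x | θ x n = true})
  have hτ : Measurable τ := by
    apply measurable_pi_lambda
    intro n
    apply measurable_to_bool
    have : (fun x => τ x n) ⁻¹' {true} = SS T H {x | θ x n = true} := by
      ext x; simp [τ]
    rw [this]
    exact SS_meas hT hH (hθn n)
  have key : ∀ E : Set (ℕ → Bool), MeasurableSet E →
      ∀ᵐ x ∂μ, τ x ∈ E ↔ x ∈ SS T H (θ ⁻¹' E) := by
    let m : MeasurableSpace (ℕ → Bool) :=
      { MeasurableSet' := fun E => MeasurableSet E ∧ ∀ᵐ x ∂μ, τ x ∈ E ↔ x ∈ SS T H (θ ⁻¹' E)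
        measurableSet_empty := by
          refine ⟨MeasurableSet.empty, ?_⟩
          have h0 : (fun x => (∅ : Set X).indicator H x) =ᵐ[μ] 0 := by simp; rfl
          have := (hT.zero hp (hH.indicator MeasurableSet.empty)).2 h0
          filter_upwards [this] with x hx
          simpa [SS] using hx
        measurableSet_compl := by
          rintro E ⟨h1, h2⟩
          refine ⟨h1.compl, ?_⟩
          filter_upwards [h2, SS_compl hT hp hp2 hH hH0 (hθ h1)] with x h3 h4
          rw [Set.preimage_compl, h4, ← h3]
          rfl
        measurableSet_iUnion := by
          intro E hE
          refine ⟨MeasurableSet.iUnion fun n => (hE n).1, ?_⟩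
          filter_upwards [ae_all_iff.2 fun n => (hE n).2,
            SS_iUnion hT hp hp2 hH hH0 (fun n => hθ (hE n).1)] with x h3 h4
          rw [Set.preimage_iUnion, h4]
          simp [h3] }
    have hle : (MeasurableSpace.pi : MeasurableSpace (ℕ → Bool)) ≤ m := by
      refine iSup_le fun n => ?_
      rw [← measurable_iff_comap_le]
      refine @measurable_to_bool _ m _ ?_
      refine ⟨measurable_pi_apply n (measurableSet_singleton true), ?_⟩
      filter_upwards with x
      simp only [τ, Set.mem_preimage, Set.mem_singleton_iff, decide_eq_true_eq]
      rfl
    intro E hE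
    exact (hle E hE).2
  have hemb := hθ.measurableEmbedding hθi
  let x0 : X := Classical.arbitrary X
  let ρ : (ℕ → Bool) → X := Function.extend θ id (fun _ => x0)
  have hρ : Measurable ρ := hemb.measurable_extend measurable_id measurable_const
  refine ⟨fun x => ρ (τ x), hρ.comp hτ, ?_⟩
  intro A hA
  filter_upwards [key _ (hρ hA)] with x hx
  have : θ ⁻¹' (ρ ⁻¹' A) = A := by
    ext y
    simp [ρ, hθi.extend_apply]
  rw [this] at hx
  exact hx

end Lamperti2


section Lamperti3

variable {X : Type*} [MeasurableSpace X] {μ : Measure X} {p : ℝ} {T : (X → ℂ) → X → ℂ}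
  {H : X → ℂ} {σ : X → X}

lemma sig_qmp (hT : LpIsom μ p T) (hp : 0 < p)
    (hH : MemLp H (ENNReal.ofReal p) μ)
    (hσ : Measurable σ) (hσS : ∀ A, MeasurableSet A → ∀ᵐ x ∂μ, σ x ∈ A ↔ x ∈ SS T H A) :
    Measure.QuasiMeasurePreserving σ μ μ := by
  refine ⟨hσ, ?_⟩
  refine Measure.AbsolutelyContinuous.mk ?_
  intro A hA hA0
  rw [Measure.map_apply hσ hA]
  have h0 : A.indicator H =ᵐ[μ] 0 := by
    have : ∀ᵐ x ∂μ, x ∉ A := measure_eq_zero_iff_ae_notMem.1 hA0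
    filter_upwards [this] with x hx
    exact Set.indicator_of_notMem hx _
  have h1 := (hT.zero hp (hH.indicator hA)).2 h0
  refine measure_eq_zero_iff_ae_notMem.2 ?_
  filter_upwards [h1, hσS A hA] with x h2 h3 h4
  exact (h3.1 h4) h2

lemma sig_ind (hT : LpIsom μ p T) (hp : 0 < p) (hp2 : p ≠ 2)
    (hH : MemLp H (ENNReal.ofReal p) μ) (hH0 : ∀ x, H x ≠ 0)
    (hσS : ∀ A, MeasurableSet A → ∀ᵐ x ∂μ, σ x ∈ A ↔ x ∈ SS T H A)
    {f : X → ℂ} (hf : MemLp f (ENNReal.ofReal p) μ) {A : Set X} (hA : MeasurableSet A) :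
    T (A.indicator f) =ᵐ[μ] (σ ⁻¹' A).indicator (T f) := by
  have h1 := SS_disj hT hp hp2 (hf.indicator hA.compl) hH hA
    (Eventually.of_forall fun x hx => Set.indicator_of_notMem (by simpa using hx) _)
  have h2 := SS_disj hT hp hp2 (hf.indicator hA) hH hA.compl
    (Eventually.of_forall fun x hx => Set.indicator_of_notMem (by simpa using hx) _)
  filter_upwards [h1, h2, hT.ind_add hf hA, hσS A hA, SS_compl hT hp hp2 hH hH0 hA]
    with x h1 h2 h3 h4 h5
  by_cases h : σ x ∈ A
  · rw [Set.indicator_of_mem (show x ∈ σ ⁻¹' A from h), h3, h1 (h4.1 h), add_zero]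
  · rw [Set.indicator_of_notMem (show x ∉ σ ⁻¹' A from h)]
    exact h2 (h5.2 fun h' => h (h4.2 h'))

lemma sig_full (hT : LpIsom μ p T) (hp : 0 < p) (hp2 : p ≠ 2)
    (hH : MemLp H (ENNReal.ofReal p) μ) (hH0 : ∀ x, H x ≠ 0)
    (hσS : ∀ A, MeasurableSet A → ∀ᵐ x ∂μ, σ x ∈ A ↔ x ∈ SS T H A)
    {B : Set X} (hB : MeasurableSet B) :
    ∃ A, MeasurableSet A ∧ ∀ᵐ x ∂μ, σ x ∈ A ↔ x ∈ B := by
  obtain ⟨k, hk, hTk⟩ := hT.surj _ ((hT.mem H hH).indicator hB)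
  obtain ⟨k', hk', hTk'⟩ := hT.surj _ ((hT.mem H hH).indicator hB.compl)
  have hd : Disj μ k k' := by
    rw [← hT.disj hp hp2 hk hk']
    filter_upwards [hTk, hTk'] with x h1 h2
    rw [h1, h2]
    by_cases h : x ∈ B
    · exact Or.inr (Set.indicator_of_notMem (by simpa using h) _)
    · exact Or.inl (Set.indicator_of_notMem h _)
  have hs : (fun x => (k x + k' x) - H x) =ᵐ[μ] 0 := by
    refine (hT.zero hp ((hk.add hk').sub hH)).1 ?_
    filter_upwards [hT.sub _ _ (hk.add hk') hH, hT.add _ _ hk hk', hTk, hTk'] with x h1 h2 h3 h4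
    refine h1.trans ?_
    have h2' : T (k + k') x = T k x + T k' x := h2
    rw [h2', h3, h4]
    by_cases h : x ∈ B
    · simp [h]
    · simp [h]
  obtain ⟨m, hm, hmk⟩ := hk.1
  have hA : MeasurableSet {x | m x ≠ 0} :=
    (measurableSet_eq_fun hm.measurable measurable_const).compl
  refine ⟨{x | m x ≠ 0}, hA, ?_⟩
  have hi : {x | m x ≠ 0}.indicator H =ᵐ[μ] k := by
    filter_upwards [hmk, hd, hs] with x h1 h2 h3
    have h3 : k x + k' x - H x = 0 := h3
    by_cases h : m x = 0
    · rw [Set.indicator_of_notMem (show x ∉ {x | m x ≠ 0} from fun h' => h' h), h1, h]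
    · rw [Set.indicator_of_mem (show x ∈ {x | m x ≠ 0} from h)]
      have : k' x = 0 := h2.resolve_left (by rw [h1]; exact h)
      rw [this] at h3
      linear_combination -h3
  have h4 := hT.congr _ _ (hH.indicator hA) hi
  filter_upwards [h4, hTk, hσS _ hA, hT.ne_zero hp hp2 hH hH0] with x h4 h5 h6 h7
  rw [h6]
  change T ({x | m x ≠ 0}.indicator H) x ≠ 0 ↔ _
  rw [h4, h5]
  by_cases h : x ∈ B
  · simp [h, h7]
  · simp [h]

lemma sig_setInt (hT : LpIsom μ p T) (hp : 0 < p) (hp2 : p ≠ 2)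
    (hH : MemLp H (ENNReal.ofReal p) μ) (hH0 : ∀ x, H x ≠ 0) (hσ : Measurable σ)
    (hσS : ∀ A, MeasurableSet A → ∀ᵐ x ∂μ, σ x ∈ A ↔ x ∈ SS T H A)
    {f : X → ℂ} (hf : MemLp f (ENNReal.ofReal p) μ) {A : Set X} (hA : MeasurableSet A) :
    ∫⁻ x in σ ⁻¹' A, ‖T f x‖ₑ ^ p ∂μ = ∫⁻ x in A, ‖f x‖ₑ ^ p ∂μ := by
  have h1 := hT.norm _ (hf.indicator hA)
  rw [NN_congr (sig_ind hT hp hp2 hH hH0 hσS hf hA)] at h1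
  have e : ∀ (F : X → ℂ) (B : Set X), MeasurableSet B →
      NN μ p (B.indicator F) = ∫⁻ x in B, ‖F x‖ₑ ^ p ∂μ := by
    intro F B hB
    rw [← lintegral_indicator hB]
    unfold NN
    congr 1; ext x
    by_cases h : x ∈ B <;> simp [h, hp]
  rwa [e _ _ (hσ hA), e _ _ hA] at h1

lemma sig_int (hT : LpIsom μ p T) (hp : 0 < p) (hp2 : p ≠ 2)
    (hH : MemLp H (ENNReal.ofReal p) μ) (hHm : Measurable H) (hH0 : ∀ x, H x ≠ 0)
    (hσ : Measurable σ)
    (hσS : ∀ A, MeasurableSet A → ∀ᵐ x ∂μ, σ x ∈ A ↔ x ∈ SS T H A)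
    {k : X → ℝ≥0∞} (hk : Measurable k) :
    ∫⁻ x, (‖T H x‖ₑ / ‖H (σ x)‖ₑ) ^ p * k (σ x) ∂μ = ∫⁻ x, k x ∂μ := by
  have hWm : Measurable (fun x => ‖T H x‖ₑ ^ p) := (hT.meas H hH).enorm.pow_const p
  have hHm' : Measurable (fun x => ‖H x‖ₑ ^ p) := hHm.enorm.pow_const p
  have hmap : (μ.withDensity (fun x => ‖T H x‖ₑ ^ p)).map σ =
      μ.withDensity (fun x => ‖H x‖ₑ ^ p) := by
    ext A hA
    rw [Measure.map_apply hσ hA, withDensity_apply _ (hσ hA), withDensity_apply _ hA]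
    exact sig_setInt hT hp hp2 hH hH0 hσ hσS hH hA
  have hkm : Measurable (fun x => (‖H x‖ₑ ^ p)⁻¹ * k x) := hHm'.inv.mul hk
  have h1 : ∫⁻ x, (‖H x‖ₑ ^ p)⁻¹ * k x ∂(μ.withDensity (fun x => ‖T H x‖ₑ ^ p)).map σ =
      ∫⁻ x, (‖H x‖ₑ ^ p)⁻¹ * k x ∂μ.withDensity (fun x => ‖H x‖ₑ ^ p) := by rw [hmap]
  rw [lintegral_map hkm hσ, lintegral_withDensity_eq_lintegral_mul _ hWm (g := fun a => (‖H (σ a)‖ₑ ^ p)⁻¹ * k (σ a))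
      (hkm.comp hσ),
    lintegral_withDensity_eq_lintegral_mul _ hHm' hkm] at h1
  have e1 : ∫⁻ x, k x ∂μ =
      ∫⁻ x, ((fun x => ‖H x‖ₑ ^ p) * fun x => (‖H x‖ₑ ^ p)⁻¹ * k x) x ∂μ := by
    congr 1; ext x
    simp only [Pi.mul_apply]
    rw [← mul_assoc, ENNReal.mul_inv_cancel, one_mul]
    · simp [hH0, hp.le, hp]
    · exact ENNReal.rpow_ne_top_of_nonneg hp.le (by simp)
  rw [e1, ← h1]
  congr 1; ext x
  simp only [Pi.mul_apply, Function.comp]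
  rw [ENNReal.div_rpow_of_nonneg _ _ hp.le, div_eq_mul_inv, mul_assoc]

lemma sig_abs [SigmaFinite μ] (hT : LpIsom μ p T) (hp : 0 < p) (hp2 : p ≠ 2)
    (hH : MemLp H (ENNReal.ofReal p) μ) (hHm : Measurable H) (hH0 : ∀ x, H x ≠ 0)
    (hσ : Measurable σ)
    (hσS : ∀ A, MeasurableSet A → ∀ᵐ x ∂μ, σ x ∈ A ↔ x ∈ SS T H A)
    {f : X → ℂ} (hf : MemLp f (ENNReal.ofReal p) μ) :
    ∀ᵐ x ∂μ, ‖T f x‖ = ‖T H x‖ / ‖H (σ x)‖ * ‖f (σ x)‖ := by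
  obtain ⟨m, hm, hmf⟩ := hf.1
  have hm' := hm.measurable
  have key : (fun x => ‖T f x‖ₑ ^ p) =ᵐ[μ]
      fun x => (‖T H x‖ₑ / ‖H (σ x)‖ₑ) ^ p * ‖m (σ x)‖ₑ ^ p := by
    apply ae_eq_of_forall_setLIntegral_eq_of_sigmaFinite
    · exact (hT.meas f hf).enorm.pow_const p
    · exact (((hT.meas H hH).enorm.div (hHm.comp hσ).enorm).pow_const p).mul
        ((hm'.comp hσ).enorm.pow_const p)
    · intro B hB _
      obtain ⟨A, hA, hAB⟩ := sig_full hT hp hp2 hH hH0 hσS hB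
      have hAB' : (σ ⁻¹' A : Set X) =ᵐ[μ] B := by
        filter_upwards [hAB] with x hx
        exact propext hx
      rw [← setLIntegral_congr hAB', ← setLIntegral_congr hAB',
        sig_setInt hT hp hp2 hH hH0 hσ hσS hf hA]
      have h2 := sig_int hT hp hp2 hH hHm hH0 hσ hσS
        (k := A.indicator fun x => ‖m x‖ₑ ^ p) ((hm'.enorm.pow_const p).indicator hA)
      rw [lintegral_indicator hA] at h2
      rw [← lintegral_indicator (hσ hA)]
      have h3 : ∫⁻ x in A, ‖f x‖ₑ ^ p ∂μ = ∫⁻ x in A, ‖m x‖ₑ ^ p ∂μ := by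
        apply lintegral_congr_ae
        filter_upwards [ae_restrict_of_ae hmf] with x hx
        rw [hx]
      rw [h3, ← h2]
      congr 1; ext x
      by_cases h : σ x ∈ A
      · rw [Set.indicator_of_mem h, Set.indicator_of_mem (show x ∈ σ ⁻¹' A from h)]
      · rw [Set.indicator_of_notMem h, Set.indicator_of_notMem (show x ∉ σ ⁻¹' A from h), mul_zero]
  have hc := (sig_qmp hT hp hH hσ hσS).ae hmf
  filter_upwards [key, hc] with x h1 h2
  rw [← ENNReal.mul_rpow_of_nonneg _ _ hp.le] at h1
  have h3 := (ENNReal.rpow_left_injective hp.ne') h1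
  rw [← h2] at h3
  have := congrArg ENNReal.toReal h3
  simpa [ENNReal.toReal_mul, ENNReal.toReal_div] using this

end Lamperti3


section Lamperti4

lemma cplx_aux {v : ℂ} (h1 : ‖v‖ = 1) (h2 : ‖1 + v‖ = ‖(1 : ℂ) + Complex.I‖) :
    v = Complex.I ∨ v = -Complex.I := by
  have a1 : ‖v‖ ^ 2 = 1 := by rw [h1]; norm_num
  have a2 : ‖1 + v‖ ^ 2 = ‖(1 : ℂ) + Complex.I‖ ^ 2 := by rw [h2]
  rw [Complex.sq_norm, Complex.normSq_apply] at a1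
  rw [Complex.sq_norm, Complex.sq_norm, Complex.normSq_apply, Complex.normSq_apply] at a2
  simp at a2
  have hre : v.re = 0 := by nlinarith
  have him : (v.im - 1) * (v.im + 1) = 0 := by rw [hre] at a1; nlinarith
  rcases mul_eq_zero.1 him with h | h
  · left; apply Complex.ext
    · simpa using hre
    · simp; linarith
  · right; apply Complex.ext
    · simpa using hre
    · simp; linarith

lemma cplx_aux2 {s z v : ℂ} (h0 : ‖s‖ = ‖z‖) (h1 : ‖s + 1‖ = ‖z + 1‖)
    (h2 : ‖s + v‖ = ‖z + Complex.I‖) :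
    (v = Complex.I → s = z) ∧ (v = -Complex.I → s = starRingEnd ℂ z) := by
  have a0 : ‖s‖ ^ 2 = ‖z‖ ^ 2 := by rw [h0]
  have a1 : ‖s + 1‖ ^ 2 = ‖z + 1‖ ^ 2 := by rw [h1]
  have a2 : ‖s + v‖ ^ 2 = ‖z + Complex.I‖ ^ 2 := by rw [h2]
  rw [Complex.sq_norm, Complex.sq_norm, Complex.normSq_apply, Complex.normSq_apply] at a0 a1 a2
  simp at a1 a2
  have hre : s.re = z.re := by nlinarith
  constructor
  · rintro rfl
    simp at a2
    apply Complex.ext hre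
    nlinarith
  · rintro rfl
    simp at a2
    apply Complex.ext
    · simpa using hre
    · simp; nlinarith

/-- the point of the unit circle in the direction of `w` -/
noncomputable def unitOf (w : ℂ) : Circle :=
  Circle.exp (Complex.arg w)

lemma unitOf_coe (w : ℂ) : (unitOf w : ℂ) = if w = 0 then 1 else w / (‖w‖ : ℂ) := by
  unfold unitOf
  rw [Circle.coe_exp]
  by_cases h : w = 0
  · rw [if_pos h, h]; simp
  · rw [if_neg h, eq_div_iff (by simpa using h), mul_comm, Complex.norm_mul_exp_arg_mul_I]

/-- the phase of Lamperti's decomposition -/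
noncomputable def eOf (w v : ℂ) : ℂ ≃ₗᵢ[ℝ] ℂ :=
  haveI := Classical.propDecidable (v = Complex.I * w)
  if v = Complex.I * w then rotation (unitOf w)⁻¹ else Complex.conjLIE.trans (rotation (unitOf w))

lemma eOf_apply (w v z : ℂ) : eOf w v z =
    if v = Complex.I * w then (starRingEnd ℂ) (unitOf w : ℂ) * z
      else (unitOf w : ℂ) * (starRingEnd ℂ) z := by
  unfold eOf
  split_ifs
  · rw [rotation_apply, Circle.coe_inv_eq_conj]
  · simp [rotation_apply]

lemma unitOf_meas : Measurable (fun w : ℂ => (unitOf w : ℂ)) := by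
  simp only [unitOf_coe]
  exact Measurable.ite (measurableSet_singleton (0 : ℂ)) measurable_const
    (measurable_id.div (Complex.measurable_ofReal.comp measurable_norm))

lemma eOf_meas : Measurable (fun z : (ℂ × ℂ) × ℂ => eOf z.1.1 z.1.2 z.2) := by
  simp only [eOf_apply]
  have hu : Measurable (fun z : (ℂ × ℂ) × ℂ => (unitOf z.1.1 : ℂ)) :=
    unitOf_meas.comp (measurable_fst.comp measurable_fst)
  refine Measurable.ite ?_ ?_ ?_
  · exact measurableSet_eq_fun (measurable_snd.comp measurable_fst)
      (measurable_const.mul (measurable_fst.comp measurable_fst))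
  · exact (Complex.continuous_conj.measurable.comp hu).mul measurable_snd
  · exact hu.mul (Complex.continuous_conj.measurable.comp measurable_snd)

variable {X : Type*} [MeasurableSpace X] {μ : Measure X} {p : ℝ} {T : (X → ℂ) → X → ℂ}

theorem lamperti [StandardBorelSpace X] [Nonempty X] [SigmaFinite μ] (hT : LpIsom μ p T)
    (hp : 0 < p) (hp2 : p ≠ 2) :
    ∃ (σ : X → X) (l : X → ℝ) (e : X → ℂ ≃ₗᵢ[ℝ] ℂ), Measurable σ ∧ Measurable l ∧
      (∀ x, 0 < l x) ∧ Measurable (fun z : X × ℂ => e z.1 z.2) ∧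
      (∀ k : X → ℝ≥0∞, Measurable k →
        ∫⁻ x, ENNReal.ofReal (l x) ^ p * k (σ x) ∂μ = ∫⁻ x, k x ∂μ) ∧
      ∀ f, MemLp f (ENNReal.ofReal p) μ → ∀ᵐ x ∂μ, e x (T f x) = (l x : ℂ) * f (σ x) := by
  classical
  obtain ⟨g, hg0, hgm, hgi⟩ := exists_pos_lintegral_lt_of_sigmaFinite μ (ε := 1) (by simp)
  let h : X → ℝ := fun x => (g x : ℝ) ^ (1 / p)
  have hpos : ∀ x, 0 < h x := fun x => Real.rpow_pos_of_pos (hg0 x) _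
  have hm : Measurable h := hgm.coe_nnreal_real.pow_const _
  let H : X → ℂ := fun x => (h x : ℂ)
  have hHm : Measurable H := Complex.measurable_ofReal.comp hm
  have hH0 : ∀ x, H x ≠ 0 := fun x => by
    simpa [H] using (hpos x).ne'
  have hH : MemLp H (ENNReal.ofReal p) μ := by
    rw [memLp_iff_NN hp]
    refine ⟨hHm.aestronglyMeasurable, ?_⟩
    refine lt_of_eq_of_lt ?_ (hgi.trans (by simp))
    unfold NN
    congr 1; ext x
    rw [enorm_rpow_ofReal hp]
    simp only [H, Complex.norm_real, Real.norm_of_nonneg (hpos x).le, h]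
    rw [← Real.rpow_mul (by positivity)]
    simp [hp.ne']
  obtain ⟨σ, hσ, hσS⟩ := exists_sigma hT hp hp2 hH hH0
  have hW0 := hT.ne_zero hp hp2 hH hH0
  have hIH : MemLp (fun x => Complex.I * H x) (ENNReal.ofReal p) μ := hH.const_mul Complex.I
  set W := T H with hW
  set V := T (fun x => Complex.I * H x) with hV
  have hWm : Measurable W := hT.meas H hH
  have hVm : Measurable V := hT.meas _ hIH
  have abs := fun {f : X → ℂ} (hf : MemLp f (ENNReal.ofReal p) μ) =>
    sig_abs hT hp hp2 hH hHm hH0 hσ hσS hf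
  refine ⟨σ, fun x => if W x = 0 then 1 else ‖W x‖ / h (σ x), fun x => eOf (W x) (V x), hσ, ?_, ?_,
    ?_, ?_, ?_⟩
  · exact Measurable.ite (measurableSet_eq_fun hWm measurable_const) measurable_const
      (hWm.norm.div (hm.comp hσ))
  · intro x
    have := hpos (σ x)
    dsimp only
    split_ifs
    · norm_num
    · positivity
  · exact eOf_meas.comp (((hWm.comp measurable_fst).prodMk (hVm.comp measurable_fst)).prodMk
      measurable_snd)
  · intro k hk
    rw [← sig_int hT hp hp2 hH hHm hH0 hσ hσS hk]
    apply lintegral_congr_ae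
    filter_upwards [hW0] with x hx
    rw [if_neg hx, ENNReal.ofReal_div_of_pos (hpos _), ofReal_norm]
    congr 3
    rw [← ofReal_norm]
    simp [H, abs_of_pos (hpos _)]
  · intro f hf
    have hfH : MemLp (fun x => f x + H x) (ENNReal.ofReal p) μ := hf.add hH
    have hfI : MemLp (fun x => f x + Complex.I * H x) (ENNReal.ofReal p) μ := hf.add hIH
    have hHI : MemLp (fun x => H x + Complex.I * H x) (ENNReal.ofReal p) μ := hH.add hIH
    filter_upwards [hW0, abs hf, abs hfH, abs hfI, abs hHI, abs hIH, hT.add _ _ hf hH,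
      hT.add _ _ hf hIH, hT.add _ _ hH hIH] with x w0 n1 n2 n3 n4 n5 a1 a2 a3
    have w0' : ‖W x‖ ≠ 0 := by simpa using w0
    have hhp := hpos (σ x)
    have hhn : ‖H (σ x)‖ = h (σ x) := by simp [H, abs_of_pos hhp]
    have hHx : H (σ x) = (h (σ x) : ℂ) := rfl
    rw [if_neg w0]
    rw [a1] at n2
    rw [a2] at n3
    rw [a3] at n4
    rw [hhn] at n1 n2 n3 n4 n5
    change ‖V x‖ = _ at n5
    change ‖T f x + V x‖ = _ at n3
    change ‖W x + V x‖ = _ at n4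
    change ‖T f x + W x‖ = _ at n2
    change ‖T f x‖ = ‖W x‖ / _ * _ at n1
    obtain ⟨s, hs⟩ : ∃ s, T f x = s * W x := ⟨T f x / W x, by field_simp⟩
    obtain ⟨v, hv⟩ : ∃ v, V x = v * W x := ⟨V x / W x, by field_simp⟩
    have hhc : (h (σ x) : ℂ) ≠ 0 := by exact_mod_cast hhp.ne'
    obtain ⟨z, hz⟩ : ∃ z, f (σ x) = z * (h (σ x) : ℂ) := ⟨f (σ x) / (h (σ x) : ℂ), by field_simp⟩
    have cancel : ∀ a b : ℂ, ‖a * W x‖ = ‖W x‖ / h (σ x) * ‖b * (h (σ x) : ℂ)‖ → ‖a‖ = ‖b‖ := by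
      intro a b hab
      rw [norm_mul, norm_mul, Complex.norm_real, Real.norm_of_nonneg hhp.le] at hab
      field_simp at hab
      exact hab
    rw [hs, hz] at n1 n2 n3
    rw [hv] at n3 n4 n5
    rw [hHx] at n2 n3 n4 n5
    have c1 := cancel s z n1
    have c2 := cancel (s + 1) (z + 1) (by rw [add_mul, add_mul, one_mul, one_mul]; exact n2)
    have c3 := cancel (s + v) (z + Complex.I) (by rw [add_mul, add_mul]; exact n3)
    have c4 := cancel (1 + v) (1 + Complex.I)
      (by rw [add_mul, add_mul, one_mul, one_mul]; exact n4)
    have c5 := cancel v Complex.I n5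
    rw [Complex.norm_I] at c5
    have hWW : (starRingEnd ℂ) (W x) * W x = (‖W x‖ : ℂ) * (‖W x‖ : ℂ) := by
      rw [Complex.conj_mul', sq]
    have hwc : (‖W x‖ : ℂ) ≠ 0 := by exact_mod_cast w0'
    rw [eOf_apply, unitOf_coe, if_neg w0, hs, hz]
    push_cast
    rcases cplx_aux c5 c4 with hvI | hvI
    · rw [if_pos (by rw [hv, hvI]), (cplx_aux2 c1 c2 c3).1 hvI]
      rw [map_div₀, Complex.conj_ofReal]
      field_simp
      linear_combination z * hWW
    · rw [if_neg, (cplx_aux2 c1 c2 c3).2 hvI]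
      · rw [map_mul, Complex.conj_conj]
        field_simp
        linear_combination z * hWW
      · rw [hv, hvI]
        intro h'
        have := mul_right_cancel₀ w0 h'
        have := congrArg Complex.im this
        norm_num at this

end Lamperti4


section Skew

/-- tent function -/
noncomputable def tent (z : ℂ) : ℝ := max 0 (1 - ‖z‖)

lemma tent_cont : Continuous tent := by unfold tent; fun_prop

lemma tent_norm {z w : ℂ} (h : ‖z‖ = ‖w‖) : tent z = tent w := by simp [tent, h]

lemma tent_lip (z w : ℂ) : ‖tent z - tent w‖ ≤ ‖z - w‖ := by
  unfold tent
  rw [Real.norm_eq_abs]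
  refine (abs_max_sub_max_le_max 0 (1 - ‖z‖) 0 (1 - ‖w‖)).trans ?_
  have : |1 - ‖z‖ - (1 - ‖w‖)| ≤ ‖z - w‖ := by
    rw [show 1 - ‖z‖ - (1 - ‖w‖) = -(‖z‖ - ‖w‖) by ring, abs_neg]
    exact abs_norm_sub_norm_le z w
  simpa using this

lemma tent_nonneg (z : ℂ) : 0 ≤ tent z := le_max_left _ _

lemma tent_le_one (z : ℂ) : tent z ≤ 1 := max_le (by norm_num) (by linarith [norm_nonneg z])

lemma tent_zero_of {z : ℂ} (h : 1 ≤ ‖z‖) : tent z = 0 := max_eq_left (by linarith)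

lemma tent_sub_le_one (z w : ℂ) : ‖tent z - tent w‖ ≤ 1 := by
  rw [Real.norm_eq_abs, abs_le]
  constructor <;> linarith [tent_nonneg z, tent_nonneg w, tent_le_one z, tent_le_one w]

/-- scaling by `exp (-r)` -/
noncomputable def sc (r : ℝ) (a : ℂ) : ℂ := a * (Real.exp (-r) : ℂ)

lemma sc_meas : Measurable (fun z : ℝ × ℂ => sc z.1 z.2) := by
  unfold sc; fun_prop

/-- inner integral -/
noncomputable def kap (q : ℝ) (a b : ℂ) : ℝ≥0∞ :=
  ∫⁻ w : ℂ, ‖tent (a - w) - tent (b - w)‖ₑ ^ q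

lemma kap_shift (q : ℝ) (a b : ℂ) : kap q a b = kap q (a - b) 0 := by
  unfold kap
  rw [← lintegral_add_right_eq_self (fun w : ℂ => ‖tent (a - w) - tent (b - w)‖ₑ ^ q) b]
  congr 1; ext w
  congr 4 <;> ring_nf

lemma kap_rot (q : ℝ) (u : Circle) (a : ℂ) : kap q (u * a) 0 = kap q a 0 := by
  unfold kap
  rw [← (rotation u).measurePreserving.lintegral_comp]
  · congr 1; ext w
    rw [rotation_apply]
    rw [tent_norm (z := u * a - u * w) (w := a - w), tent_norm (z := 0 - u * w) (w := 0 - w)]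
    · rw [zero_sub, zero_sub, norm_neg, norm_neg, norm_mul, Circle.norm_coe, one_mul]
    · rw [← mul_sub, norm_mul, Circle.norm_coe, one_mul]
  · have := tent_cont.measurable
    fun_prop

lemma kap_bound {q : ℝ} (hq : 0 < q) (a : ℂ) :
    kap q a 0 ≤ ENNReal.ofReal (min 1 ‖a‖) ^ q * (2 * volume (Metric.closedBall (0 : ℂ) 1)) := by
  have h : ∀ w : ℂ, ‖tent (a - w) - tent (0 - w)‖ₑ ^ q ≤ ENNReal.ofReal (min 1 ‖a‖) ^ q *
      ((Metric.closedBall (0 : ℂ) 1 ∪ Metric.closedBall a 1).indicator 1 w) := by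
    intro w
    by_cases hw : w ∈ Metric.closedBall (0 : ℂ) 1 ∪ Metric.closedBall a 1
    · rw [Set.indicator_of_mem hw, Pi.one_apply, mul_one]
      apply ENNReal.rpow_le_rpow _ hq.le
      rw [← ofReal_norm]
      apply ENNReal.ofReal_le_ofReal
      apply le_min (tent_sub_le_one _ _)
      refine (tent_lip _ _).trans ?_
      simp
    · simp only [Set.mem_union, not_or, Metric.mem_closedBall, not_le, dist_zero_right] at hw
      rw [tent_zero_of, tent_zero_of]
      · simp [hq]
      · simpa using hw.1.le
      · rw [← dist_eq_norm, dist_comm]; exact hw.2.le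
  refine (lintegral_mono h).trans ?_
  rw [lintegral_const_mul' _ _ (ENNReal.rpow_ne_top_of_nonneg hq.le (by simp))]
  gcongr
  rw [lintegral_indicator_one (by measurability)]
  refine (measure_union_le _ _).trans ?_
  rw [two_mul]
  rw [Measure.addHaar_closedBall_center volume a]

lemma kap_meas (q : ℝ) : Measurable (fun z : ℂ × ℂ => kap q z.1 z.2) := by
  unfold kap
  have := tent_cont.measurable
  refine Measurable.lintegral_prod_right' (f := fun z : (ℂ × ℂ) × ℂ =>
    ‖tent (z.1.1 - z.2) - tent (z.1.2 - z.2)‖ₑ ^ q) ?_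
  fun_prop

/-- double integral -/
noncomputable def JJ (p q : ℝ) (a b : ℂ) : ℝ≥0∞ :=
  ∫⁻ r : ℝ, ENNReal.ofReal (Real.exp (p * r)) * kap q (sc r a) (sc r b)

lemma JJ_shift (p q : ℝ) (a b : ℂ) : JJ p q a b = JJ p q (a - b) 0 := by
  unfold JJ
  congr 1; ext r
  rw [kap_shift]
  simp [sc, sub_mul]

lemma JJ_zero {p q : ℝ} (hq : 0 < q) : JJ p q 0 0 = 0 := by
  unfold JJ kap
  simp [hq]

lemma JJ_scale {p q : ℝ} (hp : 0 < p) (hq : 0 < q) (a b : ℂ) :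
    JJ p q a b = ‖a - b‖ₑ ^ p * JJ p q 1 0 := by
  rw [JJ_shift]
  set d := a - b
  by_cases hd : d = 0
  · rw [hd, JJ_zero hq]; simp [hp]
  have hd0 : 0 < ‖d‖ := by simpa using hd
  have e1 : JJ p q d 0 = JJ p q (‖d‖ : ℂ) 0 := by
    unfold JJ
    congr 1; ext r
    have : sc r d = unitOf d * sc r (‖d‖ : ℂ) := by
      rw [unitOf_coe, if_neg hd]
      unfold sc
      have : (‖d‖ : ℂ) ≠ 0 := by exact_mod_cast hd0.ne'
      field_simp
    rw [this]
    have h0 : sc r 0 = 0 := by simp [sc]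
    rw [h0, kap_rot]
  rw [e1]
  unfold JJ
  rw [← lintegral_add_right_eq_self _ (Real.log ‖d‖)]
  rw [← lintegral_const_mul' _ _ (ENNReal.rpow_ne_top_of_nonneg hp.le (by simp))]
  congr 1; ext r
  have h1 : sc (r + Real.log ‖d‖) (‖d‖ : ℂ) = sc r 1 := by
    unfold sc
    rw [neg_add, Real.exp_add, Real.exp_neg (Real.log _), Real.exp_log hd0]
    have : (‖d‖ : ℂ) ≠ 0 := by exact_mod_cast hd0.ne'
    push_cast
    field_simp
  have h0 : ∀ r, sc r 0 = 0 := by simp [sc]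
  rw [h1, h0, h0, ← mul_assoc]
  congr 1
  rw [mul_add, Real.exp_add, ENNReal.ofReal_mul (by positivity), mul_comm, enorm_rpow_ofReal hp,
    Real.rpow_def_of_pos hd0, mul_comm p (Real.log _)]

lemma JJ_lt_top {p q : ℝ} (hp : 0 < p) (hpq : p < q) : JJ p q 1 0 < ⊤ := by
  have hq : 0 < q := hp.trans hpq
  set V := 2 * volume (Metric.closedBall (0 : ℂ) 1)
  have hV : V ≠ ⊤ := by
    have : volume (Metric.closedBall (0 : ℂ) 1) ≠ ⊤ := measure_closedBall_lt_top.ne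
    finiteness
  have hb : ∀ r, ENNReal.ofReal (Real.exp (p * r)) * kap q (sc r 1) (sc r 0) ≤
      ENNReal.ofReal (Real.exp (-(min p (q - p)) * |r|)) * V := by
    intro r
    have h0 : sc r 0 = 0 := by simp [sc]
    have h1 : ‖sc r 1‖ = Real.exp (-r) := by
      simp only [sc, one_mul, Complex.norm_real, Real.norm_eq_abs, abs_of_pos (Real.exp_pos _)]
    rw [h0]
    refine (mul_le_mul_right (kap_bound hq _) _).trans ?_
    rw [h1, ← mul_assoc]
    gcongr
    have hmin : (0 : ℝ) ≤ min 1 (Real.exp (-r)) := by positivity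
    rw [ENNReal.ofReal_rpow_of_nonneg hmin hq.le, ← ENNReal.ofReal_mul (by positivity)]
    apply ENNReal.ofReal_le_ofReal
    rcases le_total 0 r with hr | hr
    · have : (min 1 (Real.exp (-r))) ^ q ≤ Real.exp (-r * q) := by
        rw [Real.exp_mul]
        exact Real.rpow_le_rpow hmin (min_le_right _ _) hq.le
      refine (mul_le_mul_of_nonneg_left this (by positivity)).trans ?_
      rw [← Real.exp_add, abs_of_nonneg hr]
      apply Real.exp_le_exp.2
      have := min_le_right p (q - p)
      nlinarith
    · have : (min 1 (Real.exp (-r))) ^ q ≤ 1 := by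
        apply Real.rpow_le_one hmin (min_le_left _ _) hq.le
      refine (mul_le_mul_of_nonneg_left this (by positivity)).trans ?_
      rw [mul_one, abs_of_nonpos hr]
      apply Real.exp_le_exp.2
      have := min_le_left p (q - p)
      nlinarith
  have hc : 0 < min p (q - p) := lt_min hp (by linarith)
  refine (lintegral_mono hb).trans_lt ?_
  rw [lintegral_mul_const' _ _ hV]
  have hintgr : Integrable (fun r : ℝ => Real.exp (-(min p (q - p)) * |r|)) := by
    set c := min p (q - p)
    rw [← integrableOn_univ, ← Set.Iic_union_Ioi (a := (0 : ℝ))]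
    apply IntegrableOn.union
    · refine (integrableOn_exp_mul_Iic hc 0).congr_fun ?_ measurableSet_Iic
      intro x hx
      have hx : x ≤ 0 := hx
      simp [abs_of_nonpos hx]
    · refine (integrableOn_exp_mul_Ioi (a := -c) (by linarith) 0).congr_fun ?_ measurableSet_Ioi
      intro x hx
      have hx : 0 < x := hx
      simp [abs_of_pos hx]
  have := hintgr.lintegral_lt_top
  exact ENNReal.mul_lt_top this hV.lt_top

lemma JJ_ne_zero {p q : ℝ} (hq : 0 < q) : JJ p q 1 0 ≠ 0 := by
  intro h
  unfold JJ at h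
  have hm : Measurable (fun r : ℝ => ENNReal.ofReal (Real.exp (p * r)) *
      kap q (sc r 1) (sc r 0)) := by
    have hs : ∀ a, Measurable (fun r : ℝ => sc r a) := by
      intro a; unfold sc; fun_prop
    have hk : Measurable (fun r : ℝ => kap q (sc r 1) (sc r 0)) :=
      (kap_meas q).comp (f := fun r : ℝ => (sc r 1, sc r 0)) ((hs 1).prodMk (hs 0))
    have he : Measurable (fun r : ℝ => ENNReal.ofReal (Real.exp (p * r))) := by fun_prop
    exact he.mul hk
  rw [lintegral_eq_zero_iff hm] at h
  obtain ⟨r, hr⟩ := h.exists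
  have h0 : sc r 0 = 0 := by simp [sc]
  have hr : ENNReal.ofReal (Real.exp (p * r)) * kap q (sc r 1) (sc r 0) = 0 := hr
  rw [mul_eq_zero, h0] at hr
  have h2 : kap q (sc r 1) 0 = 0 := hr.resolve_left (by simp [Real.exp_pos])
  unfold kap at h2
  have ht := tent_cont
  rw [lintegral_eq_zero_iff (by have := tent_cont.measurable; fun_prop)] at h2
  have h3 : (fun w : ℂ => tent (sc r 1 - w) - tent (0 - w)) =ᵐ[volume] fun _ => 0 := by
    filter_upwards [h2] with w hw
    simpa [hq, hq.le] using hw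
  rw [Continuous.ae_eq_iff_eq volume (by fun_prop) (by fun_prop)] at h3
  have h4 := congrFun h3 0
  have h5 : ‖sc r 1‖ = Real.exp (-r) := by
    simp only [sc, one_mul, Complex.norm_real, Real.norm_eq_abs, abs_of_pos (Real.exp_pos _)]
  have h6 := Real.exp_pos (-r)
  simp only [tent, sub_zero, h5, norm_zero] at h4
  have : max 0 (1 - Real.exp (-r)) < 1 := max_lt (by norm_num) (by linarith)
  norm_num at h4
  linarith

end Skew


section Skew2

variable {X : Type*} [MeasurableSpace X]

/-- the measure `exp (p r) dr` -/
noncomputable def rho (p : ℝ) : Measure ℝ :=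
  volume.withDensity (fun r => ENNReal.ofReal (Real.exp (p * r)))

instance rho_sf (p : ℝ) : SigmaFinite (rho p) := by
  unfold rho
  exact SigmaFinite.withDensity_ofReal _

/-- the measure on the skew product -/
noncomputable def nuu (μ : Measure X) (p : ℝ) : Measure (X × ℝ × ℂ) :=
  μ.prod ((rho p).prod volume)

instance nuu_sf (μ : Measure X) [SigmaFinite μ] (p : ℝ) : SigmaFinite (nuu μ p) := by
  unfold nuu
  infer_instance

/-- fibre integral -/
noncomputable def fib (p : ℝ) (F : X × ℝ × ℂ → ℝ≥0∞) (x : X) : ℝ≥0∞ :=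
  ∫⁻ r : ℝ, ENNReal.ofReal (Real.exp (p * r)) * ∫⁻ w : ℂ, F (x, r, w)

lemma fib_eq (p : ℝ) {F : X × ℝ × ℂ → ℝ≥0∞} (hF : Measurable F) (x : X) :
    ∫⁻ z, F (x, z) ∂((rho p).prod volume) = fib p F x := by
  have h1 : Measurable (fun z : ℝ × ℂ => F (x, z)) := hF.comp measurable_prodMk_left
  rw [lintegral_prod _ h1.aemeasurable]
  unfold rho fib
  have h2 : Measurable (fun r : ℝ => ∫⁻ w : ℂ, F (x, r, w)) :=
    Measurable.lintegral_prod_right' (f := fun z : ℝ × ℂ => F (x, z)) h1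
  rw [lintegral_withDensity_eq_lintegral_mul _ (by fun_prop) h2]
  rfl

lemma lint_nuu (μ : Measure X) [SigmaFinite μ] (p : ℝ) {F : X × ℝ × ℂ → ℝ≥0∞}
    (hF : Measurable F) : ∫⁻ y, F y ∂(nuu μ p) = ∫⁻ x, fib p F x ∂μ := by
  unfold nuu
  rw [lintegral_prod _ hF.aemeasurable]
  simp only [fib_eq p hF]

lemma fib_meas (p : ℝ) {F : X × ℝ × ℂ → ℝ≥0∞} (hF : Measurable F) :
    Measurable (fib p F) := by
  have : Measurable (fun x => ∫⁻ z, F (x, z) ∂((rho p).prod (volume : Measure ℂ))) :=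
    Measurable.lintegral_prod_right' hF
  simpa only [fib_eq p hF] using this

/-- skew product map -/
noncomputable def KK (σ : X → X) (l : X → ℝ) (e : X → ℂ ≃ₗᵢ[ℝ] ℂ) (b : X → ℂ) :
    X × ℝ × ℂ → X × ℝ × ℂ :=
  fun y => (σ y.1, y.2.1 - Real.log (l y.1), e y.1 (y.2.2 - sc y.2.1 (b y.1)))

lemma KK_meas {σ : X → X} {l : X → ℝ} {e : X → ℂ ≃ₗᵢ[ℝ] ℂ} {b : X → ℂ} (hσ : Measurable σ)
    (hl : Measurable l) (he : Measurable (fun z : X × ℂ => e z.1 z.2)) (hb : Measurable b) :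
    Measurable (KK σ l e b) := by
  have hs : Measurable (fun y : X × ℝ × ℂ => sc y.2.1 (b y.1)) := by
    unfold sc; fun_prop
  have h3 : Measurable (fun y : X × ℝ × ℂ => e y.1 (y.2.2 - sc y.2.1 (b y.1))) :=
    he.comp (f := fun y : X × ℝ × ℂ => (y.1, y.2.2 - sc y.2.1 (b y.1)))
      (measurable_fst.prodMk ((measurable_snd.comp measurable_snd).sub hs))
  have h1 : Measurable (fun y : X × ℝ × ℂ => σ y.1) := hσ.comp measurable_fst
  have h2 : Measurable (fun y : X × ℝ × ℂ => y.2.1 - Real.log (l y.1)) := by fun_prop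
  exact h1.prodMk (h2.prodMk h3)

lemma fib_KK {p : ℝ} {σ : X → X} {l : X → ℝ} (hl0 : ∀ x, 0 < l x)
    {e : X → ℂ ≃ₗᵢ[ℝ] ℂ} {b : X → ℂ} {F : X × ℝ × ℂ → ℝ≥0∞} (hF : Measurable F) (x : X) :
    fib p (fun y => F (KK σ l e b y)) x = ENNReal.ofReal (l x) ^ p * fib p F (σ x) := by
  unfold fib KK
  have h1 : ∀ r : ℝ, ∫⁻ w : ℂ, F (σ x, r - Real.log (l x), e x (w - sc r (b x))) =
      ∫⁻ w : ℂ, F (σ x, r - Real.log (l x), w) := by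
    intro r
    have hm : Measurable (fun w : ℂ => F (σ x, r - Real.log (l x), w)) :=
      hF.comp (by fun_prop)
    rw [lintegral_sub_right_eq_self (fun w : ℂ => F (σ x, r - Real.log (l x), e x w)) (sc r (b x))]
    exact (e x).measurePreserving.lintegral_comp hm
  simp only [h1]
  rw [← lintegral_add_right_eq_self _ (Real.log (l x))]
  rw [← lintegral_const_mul']
  · congr 1; ext r
    rw [← mul_assoc, add_sub_cancel_right]
    congr 1
    rw [mul_add, Real.exp_add, ENNReal.ofReal_mul (by positivity), mul_comm,
      ENNReal.ofReal_rpow_of_pos (hl0 x), Real.rpow_def_of_pos (hl0 x), mul_comm p (Real.log _)]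
  · rw [ENNReal.ofReal_rpow_of_pos (hl0 x)]; simp

lemma KK_mp {μ : Measure X} [SigmaFinite μ] {p : ℝ} {σ : X → X} {l : X → ℝ}
    {e : X → ℂ ≃ₗᵢ[ℝ] ℂ} {b : X → ℂ} (hσ : Measurable σ)
    (hl : Measurable l) (hl0 : ∀ x, 0 < l x) (he : Measurable (fun z : X × ℂ => e z.1 z.2))
    (hb : Measurable b)
    (hintgr : ∀ k : X → ℝ≥0∞, Measurable k →
        ∫⁻ x, ENNReal.ofReal (l x) ^ p * k (σ x) ∂μ = ∫⁻ x, k x ∂μ) :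
    MeasurePreserving (KK σ l e b) (nuu μ p) (nuu μ p) := by
  have hK := KK_meas hσ hl he hb
  refine ⟨hK, ?_⟩
  ext s hs
  rw [Measure.map_apply hK hs, ← lintegral_indicator_one (hK hs), ← lintegral_indicator_one hs]
  have hF : Measurable (s.indicator (1 : X × ℝ × ℂ → ℝ≥0∞)) := measurable_one.indicator hs
  have e1 : (KK σ l e b ⁻¹' s).indicator (1 : X × ℝ × ℂ → ℝ≥0∞) =
      fun y => s.indicator (1 : X × ℝ × ℂ → ℝ≥0∞) (KK σ l e b y) := by
    ext y; rfl
  rw [e1, lint_nuu μ p (F := fun y => s.indicator (1 : X × ℝ × ℂ → ℝ≥0∞) (KK σ l e b y))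
    (hF.comp hK), lint_nuu μ p hF]
  simp only [fib_KK hl0 hF]
  exact hintgr _ (fib_meas p hF)

/-- the cocycle of differences -/
noncomputable def DDf (f f' : X → ℂ) (y : X × ℝ × ℂ) : ℝ :=
  tent (sc y.2.1 (f y.1) - y.2.2) - tent (sc y.2.1 (f' y.1) - y.2.2)

lemma DDf_meas {f f' : X → ℂ} (hf : Measurable f) (hf' : Measurable f') :
    Measurable (DDf f f') := by
  have := tent_cont.measurable
  unfold DDf sc
  fun_prop

lemma DDf_NN {μ : Measure X} [SigmaFinite μ] {p q : ℝ} (hp : 0 < p) (hpq : p < q)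
    {f f' : X → ℂ} (hf : Measurable f) (hf' : Measurable f') :
    NN (nuu μ p) q (DDf f f') = JJ p q 1 0 * NN μ p (fun x => f x - f' x) := by
  unfold NN
  rw [lint_nuu μ p ((DDf_meas hf hf').enorm.pow_const q),
    ← lintegral_const_mul' _ _ (JJ_lt_top hp hpq).ne]
  congr 1; ext x
  rw [mul_comm, ← JJ_scale hp (hp.trans hpq)]
  rfl

lemma DDf_KK {σ : X → X} {l : X → ℝ} (hl0 : ∀ x, 0 < l x)
    {e : X → ℂ ≃ₗᵢ[ℝ] ℂ} {b : X → ℂ} {f F : X → ℂ} {x : X}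
    (h : e x (F x - b x) = (l x : ℂ) * f (σ x)) (r : ℝ) (w : ℂ) :
    tent (sc (r - Real.log (l x)) (f (σ x)) - e x (w - sc r (b x))) = tent (sc r (F x) - w) := by
  have h1 : sc (r - Real.log (l x)) (f (σ x)) = e x (sc r (F x - b x)) := by
    have h2 : sc r (F x - b x) = Real.exp (-r) • (F x - b x) := by
      simp [sc, mul_comm]
    rw [h2, map_smul, h]
    unfold sc
    rw [neg_sub, sub_eq_add_neg, Real.exp_add, Real.exp_log (hl0 x)]
    simp
    ring
  rw [h1, ← map_sub]
  apply tent_norm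
  rw [LinearIsometryEquiv.norm_map]
  congr 1
  unfold sc; ring

end Skew2


section TentInj

lemma tent_zero_val : tent 0 = 1 := by simp [tent]

lemma sc_inv (r : ℝ) (a : ℂ) : sc r (a * (Real.exp r : ℂ)) = a := by
  unfold sc
  rw [mul_assoc, ← Complex.ofReal_mul, ← Real.exp_add]
  simp

lemma exists_big (r r' : ℝ) (w w' : ℂ) :
    ∃ c : ℂ, tent (sc r c - w) = 0 ∧ tent (sc r' c - w') = 0 := by
  obtain ⟨t, ht1, ht2⟩ : ∃ t : ℝ, (1 + ‖w‖) * Real.exp r ≤ t ∧ (1 + ‖w'‖) * Real.exp r' ≤ t :=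
    ⟨max _ _, le_max_left _ _, le_max_right _ _⟩
  have key : ∀ (r : ℝ) (w : ℂ), (1 + ‖w‖) * Real.exp r ≤ t → tent (sc r (t : ℂ) - w) = 0 := by
    intro r w h
    apply tent_zero_of
    have h1 : ‖sc r (t : ℂ)‖ = |t| * Real.exp (-r) := by
      simp only [sc, norm_mul, Complex.norm_real, Real.norm_eq_abs, abs_of_pos (Real.exp_pos _)]
    have h2 : 1 + ‖w‖ ≤ |t| * Real.exp (-r) := by
      rw [Real.exp_neg, ← div_eq_mul_inv, le_div_iff₀ (Real.exp_pos r)]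
      exact h.trans (le_abs_self t)
    have h3 := norm_sub_norm_le (sc r (t : ℂ)) w
    rw [h1] at h3
    linarith
  exact ⟨t, key r w ht1, key r' w' ht2⟩

lemma tent_nonconst {r : ℝ} {w : ℂ} {S : Set ℂ} (hS : Dense S)
    (h : ∀ c ∈ S, tent (sc r c - w) - tent (sc r 0 - w) = 0) : False := by
  have hcont : Continuous (fun c => tent (sc r c - w) - tent (sc r 0 - w)) := by
    have := tent_cont
    unfold sc; fun_prop
  have hall : ∀ c, tent (sc r c - w) - tent (sc r 0 - w) = 0 := by
    have := hcont.ext_on hS continuous_const h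
    exact fun c => congrFun this c
  obtain ⟨c, hc, -⟩ := exists_big r r w w
  have h1 := hall c
  have h2 := hall (w * (Real.exp r : ℂ))
  rw [sc_inv, sub_self, tent_zero_val] at h2
  rw [hc] at h1
  linarith

lemma tent_inj {r r' : ℝ} {w w' : ℂ} {S : Set ℂ} (hS : Dense S)
    (h : ∀ c ∈ S, tent (sc r c - w) - tent (sc r 0 - w) =
      tent (sc r' c - w') - tent (sc r' 0 - w')) : r = r' ∧ w = w' := by
  have hcont : ∀ r w, Continuous (fun c => tent (sc r c - w) - tent (sc r 0 - w)) := by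
    intro r w
    have := tent_cont
    unfold sc; fun_prop
  have hall : ∀ c, tent (sc r c - w) - tent (sc r 0 - w) =
      tent (sc r' c - w') - tent (sc r' 0 - w') := by
    have := (hcont r w).ext_on hS (hcont r' w') h
    exact fun c => congrFun this c
  obtain ⟨c, hc, hc'⟩ := exists_big r r' w w'
  have h1 := hall c
  rw [hc, hc'] at h1
  have h2 : ∀ c, tent (sc r c - w) = tent (sc r' c - w') := by
    intro c
    linarith [hall c]
  have h3 := h2 (w * (Real.exp r : ℂ))
  rw [sc_inv, sub_self, tent_zero_val] at h3
  have n1 : sc r' (w * (Real.exp r : ℂ)) = w' := by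
    have : ‖sc r' (w * (Real.exp r : ℂ)) - w'‖ ≤ 0 := by
      by_contra hh
      push Not at hh
      unfold tent at h3
      have : max 0 (1 - ‖sc r' (w * (Real.exp r : ℂ)) - w'‖) < 1 :=
        max_lt (by norm_num) (by linarith)
      linarith
    rw [norm_le_zero_iff, sub_eq_zero] at this
    exact this
  have h4 := h2 ((w + (1 / 2 : ℝ)) * (Real.exp r : ℂ))
  rw [sc_inv] at h4
  have n2 : sc r' ((w + (1 / 2 : ℝ)) * (Real.exp r : ℂ)) - w' =
      ((1 / 2 * Real.exp (r - r') : ℝ) : ℂ) := by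
    rw [← n1]
    unfold sc
    rw [sub_eq_add_neg r, Real.exp_add]
    push_cast
    ring
  rw [n2, add_sub_cancel_left] at h4
  unfold tent at h4
  rw [Complex.norm_real, Complex.norm_real, Real.norm_eq_abs, Real.norm_eq_abs,
    abs_of_pos (by norm_num), abs_of_pos (by positivity)] at h4
  have n3 : Real.exp (r - r') = 1 := by
    rw [max_eq_right (by norm_num : (0 : ℝ) ≤ 1 - 1 / 2)] at h4
    rcases le_total 0 (1 - 1 / 2 * Real.exp (r - r')) with h5 | h5
    · rw [max_eq_right h5] at h4
      linarith
    · rw [max_eq_left h5] at h4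
      norm_num at h4
  have n4 : r = r' := by
    rw [Real.exp_eq_one_iff] at n3
    linarith
  subst n4
  rw [sc_inv] at n1
  exact ⟨rfl, n1⟩

end TentInj


section Assemble

variable {G : Type*} [Group G] [TopologicalSpace G]

/-- linear part -/
noncomputable def linPart {X : Type*} [MeasurableSpace X] {μ : Measure X} {p : ℝ}
    (α : AffineIsometricAction G μ p) (g : G) (f : Lp ℂ (ENNReal.ofReal p) μ) :
    Lp ℂ (ENNReal.ofReal p) μ := α.act g f - α.act g 0

lemma linPart_smul {X : Type*} [MeasurableSpace X] {μ : Measure X} {p : ℝ}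
    (α : AffineIsometricAction G μ p) (g : G) (t : ℝ) (f : Lp ℂ (ENNReal.ofReal p) μ) :
    linPart α g (t • f) = t • linPart α g f := by
  unfold linPart
  have h := α.affine g t f 0
  rw [smul_zero, add_zero] at h
  rw [h]; module

lemma linPart_add {X : Type*} [MeasurableSpace X] {μ : Measure X} {p : ℝ}
    (α : AffineIsometricAction G μ p) (g : G) (f f' : Lp ℂ (ENNReal.ofReal p) μ) :
    linPart α g (f + f') = linPart α g f + linPart α g f' := by
  have h := α.affine g (1 / 2) ((2 : ℝ) • f) ((2 : ℝ) • f')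
  have e : (1 / 2 : ℝ) • (2 : ℝ) • f + (1 - 1 / 2 : ℝ) • (2 : ℝ) • f' = f + f' := by module
  rw [e] at h
  have h1 := linPart_smul α g 2 f
  have h2 := linPart_smul α g 2 f'
  unfold linPart at *
  rw [sub_eq_iff_eq_add] at h1 h2
  rw [h, h1, h2]; module

lemma linPart_sub {X : Type*} [MeasurableSpace X] {μ : Measure X} {p : ℝ}
    (α : AffineIsometricAction G μ p) (g : G) (f f' : Lp ℂ (ENNReal.ofReal p) μ) :
    linPart α g (f - f') = linPart α g f - linPart α g f' := by
  have h := linPart_add α g (f - f') f'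
  rw [sub_add_cancel] at h
  rw [h, add_sub_cancel_right]

lemma NN_coe_sub {X : Type*} [MeasurableSpace X] {μ : Measure X} {p : ℝ}
    (f f' : Lp ℂ (ENNReal.ofReal p) μ) :
    pPow μ p ((f : X →ₘ[μ] ℂ) - (f' : X →ₘ[μ] ℂ)) = NN μ p (fun x => f x - f' x) := by
  rw [pPow_eq_NN]
  exact NN_congr (AEEqFun.coeFn_sub _ _)

/-- linear part as a map on functions -/
noncomputable def Tfun {X : Type*} [MeasurableSpace X] {μ : Measure X} {p : ℝ}
    (α : AffineIsometricAction G μ p) (g : G) (f : X → ℂ) : X → ℂ :=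
  haveI := Classical.propDecidable (MemLp f (ENNReal.ofReal p) μ)
  if h : MemLp f (ENNReal.ofReal p) μ then (linPart α g (h.toLp f) : X → ℂ) else 0

lemma Tfun_of {X : Type*} [MeasurableSpace X] {μ : Measure X} {p : ℝ}
    (α : AffineIsometricAction G μ p) (g : G) {f : X → ℂ} (h : MemLp f (ENNReal.ofReal p) μ) :
    Tfun α g f = (linPart α g (h.toLp f) : X → ℂ) := by
  unfold Tfun
  rw [dif_pos h]

lemma Tfun_isom {X : Type*} [MeasurableSpace X] {μ : Measure X} {p : ℝ}
    (α : AffineIsometricAction G μ p) (g : G) : LpIsom μ p (Tfun α g) where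
  mem f hf := by rw [Tfun_of α g hf]; exact Lp.memLp _
  meas f hf := by rw [Tfun_of α g hf]; exact (Lp.stronglyMeasurable _).measurable
  congr f f' hf h := by
    have hf' := (memLp_congr_ae h).1 hf
    rw [Tfun_of α g hf, Tfun_of α g hf', MemLp.toLp_congr hf hf' h]
  add f f' hf hf' := by
    rw [Tfun_of α g hf, Tfun_of α g hf']
    have : Tfun α g (fun x => f x + f' x) = _ := Tfun_of α g (hf.add hf')
    rw [this, MemLp.toLp_add, linPart_add]
    exact Lp.coeFn_add _ _
  sub f f' hf hf' := by
    rw [Tfun_of α g hf, Tfun_of α g hf']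
    have : Tfun α g (fun x => f x - f' x) = _ := Tfun_of α g (hf.sub hf')
    rw [this, MemLp.toLp_sub, linPart_sub]
    exact Lp.coeFn_sub _ _
  norm f hf := by
    rw [Tfun_of α g hf]
    have h := α.isometry g (hf.toLp f) 0
    rw [NN_coe_sub, NN_coe_sub] at h
    rw [← NN_congr (hf.coeFn_toLp)]
    unfold linPart
    rw [NN_congr (Lp.coeFn_sub _ _)]
    refine h.trans (NN_congr ?_)
    filter_upwards [Lp.coeFn_zero ℂ (ENNReal.ofReal p) μ] with x hx
    rw [hx]; simp
  surj k hk := by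
    refine ⟨(α.act g⁻¹ (hk.toLp k + α.act g 0) : X → ℂ), Lp.memLp _, ?_⟩
    rw [Tfun_of α g (Lp.memLp _), Lp.toLp_coeFn]
    unfold linPart
    rw [← α.act_mul, mul_inv_cancel, α.act_one, add_sub_cancel_right]
    exact hk.coeFn_toLp

lemma exists_sets {X : Type} [MeasurableSpace X] [StandardBorelSpace X] (μ : Measure X)
    [SigmaFinite μ] : ∃ A : ℕ × ℕ × Bool → Set X, (∀ n, MeasurableSet (A n)) ∧
      (∀ n, μ (A n) < ⊤) ∧ (∀ x, ∃ n, x ∈ A n) ∧ ∀ x x', x ≠ x' → ∃ n, x ∈ A n ∧ x' ∉ A n := by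
  obtain ⟨θ, hθ, hθi⟩ := MeasurableSpace.measurable_injection_nat_bool_of_countablySeparated X
  refine ⟨fun n => {x | θ x n.1 = n.2.2} ∩ spanningSets μ n.2.1, ?_, ?_, ?_, ?_⟩
  · intro n
    exact MeasurableSet.inter ((measurable_pi_apply n.1).comp hθ (measurableSet_singleton n.2.2))
      (measurableSet_spanningSets μ _)
  · intro n
    exact (measure_mono Set.inter_subset_right).trans_lt (measure_spanningSets_lt_top μ _)
  · intro x
    exact ⟨(0, spanningSetsIndex μ x, θ x 0), rfl, mem_spanningSetsIndex μ x⟩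
  · intro x x' h
    have : θ x ≠ θ x' := fun h' => h (hθi h')
    obtain ⟨n, hn⟩ := Function.ne_iff.1 this
    exact ⟨(n, spanningSetsIndex μ x, θ x n), ⟨rfl, mem_spanningSetsIndex μ x⟩,
      fun h' => hn h'.1.symm⟩

lemma ae_fst {X : Type*} [MeasurableSpace X] {μ : Measure X} {p : ℝ} {P : X → Prop}
    (h : ∀ᵐ x ∂μ, P x) : ∀ᵐ y ∂(nuu μ p), P y.1 :=
  (Measure.quasiMeasurePreserving_fst (μ := μ) (ν := (rho p).prod volume)).ae h

lemma unb_zero {X : Type*} [MeasurableSpace X] {μ : Measure X} {p : ℝ} (hp : 0 < p)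
    (α : AffineIsometricAction G μ p) (hα : α.HasUnboundedOrbit) :
    ¬ ∃ C : ℝ≥0∞, C ≠ ⊤ ∧ ∀ g : G, NN μ p (fun x => α.act g 0 x) ≤ C := by
  rintro ⟨C, hC, h⟩
  obtain ⟨f, hf⟩ := hα
  apply hf
  refine ⟨2 ^ p * (NN μ p (fun x => f x - (0 : Lp ℂ (ENNReal.ofReal p) μ) x) + C), ?_, ?_⟩
  · have := ((memLp_iff_NN hp).1 ((Lp.memLp f).sub (Lp.memLp (0 : Lp ℂ (ENNReal.ofReal p) μ)))).2
    change NN μ p (fun x => f x - (0 : Lp ℂ (ENNReal.ofReal p) μ) x) < ⊤ at this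
    have h2 : (2 : ℝ≥0∞) ^ p ≠ ⊤ := ENNReal.rpow_ne_top_of_nonneg hp.le (by simp)
    finiteness
  · intro g
    rw [pPow_eq_NN]
    refine (NN_le_add hp (F1 := fun x => α.act g f x - α.act g 0 x)
      (F2 := fun x => α.act g 0 x) ((Lp.aestronglyMeasurable _).sub (Lp.aestronglyMeasurable _))
      (Eventually.of_forall fun x => ?_)).trans ?_
    · refine le_trans (le_of_eq ?_) (norm_add_le _ _)
      rw [sub_add_cancel]
    · have h1 := α.isometry g f 0
      rw [NN_coe_sub, NN_coe_sub] at h1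
      rw [h1]
      gcongr
      exact h g

theorem case_ne_two {p q : ℝ} (hp : 0 < p) (hp2 : p ≠ 2) (hpq : p < q)
    {X : Type} [MeasurableSpace X] [StandardBorelSpace X] {μ : Measure X} [SigmaFinite μ]
    (α : AffineIsometricAction G μ p) (hα : α.HasUnboundedOrbit) :
    ∃ β : AffineIsometricAction G (nuu μ p) q, β.HasUnboundedOrbit := by
  classical
  have hq : 0 < q := hp.trans hpq
  have hunb := unb_zero hp α hα
  rcases isEmpty_or_nonempty X with hX | hX
  · exfalso
    apply hunb
    refine ⟨0, by simp, fun g => ?_⟩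
    unfold NN
    simp [Measure.eq_zero_of_isEmpty μ]
  have hlam := fun g => lamperti (Tfun_isom α g) hp hp2
  choose σ l e hσ hl hl0 he hintgr hTf using hlam
  have hm : ∀ f : Lp ℂ (ENNReal.ofReal p) μ, Measurable (f : X → ℂ) := fun f =>
    (Lp.stronglyMeasurable f).measurable
  set J := JJ p q 1 0 with hJ
  have hJt : J ≠ ⊤ := (JJ_lt_top hp hpq).ne
  have hJ0 : J ≠ 0 := JJ_ne_zero hq
  have hNN : ∀ f f' : Lp ℂ (ENNReal.ofReal p) μ, NN (nuu μ p) q (DDf (f : X → ℂ) (f' : X → ℂ)) =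
      J * NN μ p (fun x => f x - f' x) := fun f f' => DDf_NN hp hpq (hm f) (hm f')
  obtain ⟨A, hAm, hAf, hAc, hAs⟩ := exists_sets μ
  obtain ⟨S, hSc, hSd⟩ := TopologicalSpace.exists_countable_dense ℂ
  have : Countable S := hSc.to_subtype
  have hzero := Lp.coeFn_zero ℂ (ENNReal.ofReal p) μ
  let K : G → X × ℝ × ℂ → X × ℝ × ℂ := fun g => KK (σ g) (l g) (e g) (α.act g 0 : X → ℂ)
  have hD0 : ∀ n : (ℕ × ℕ × Bool) × S, ∀ y : X × ℝ × ℂ,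
      DDf ((A n.1).indicator (fun _ => (n.2 : ℂ))) (fun _ => 0) y =
      if y.1 ∈ A n.1 then tent (sc y.2.1 n.2 - y.2.2) - tent (sc y.2.1 0 - y.2.2) else 0 := by
    intro n y
    unfold DDf
    by_cases h : y.1 ∈ A n.1
    · rw [Set.indicator_of_mem h, if_pos h]
    · rw [Set.indicator_of_notMem h, if_neg h, sub_self]
  refine framework (nuu μ p) hq α.act α.act_one α.act_mul K
    (fun g => KK_mp (hσ g) (hl g) (hl0 g) (he g) (hm _) (hintgr g))
    (fun f f' => DDf (f : X → ℂ) (f' : X → ℂ))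
    (fun f f' => (DDf_meas (hm f) (hm f')).aestronglyMeasurable) ?_ ?_ ?_ ?_ 0 ?_
    (ι := (ℕ × ℕ × Bool) × S)
    (fun n => indicatorConstLp (ENNReal.ofReal p) (hAm n.1) (hAf n.1).ne (n.2 : ℂ))
    (fun n => DDf ((A n.1).indicator (fun _ => (n.2 : ℂ))) (fun _ => 0))
    (fun n => DDf_meas (measurable_const.indicator (hAm n.1)) measurable_const) ?_ ?_ ?_
  · intro f f'
    rw [hNN]
    have := ((memLp_iff_NN hp).1 ((Lp.memLp f).sub (Lp.memLp f'))).2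
    exact ENNReal.mul_lt_top hJt.lt_top this
  · intro f f' f''
    filter_upwards with y
    unfold DDf; ring
  · intro g f f'
    have key : ∀ f : Lp ℂ (ENNReal.ofReal p) μ, ∀ᵐ x ∂μ,
        e g x (α.act g f x - α.act g 0 x) = (l g x : ℂ) * f (σ g x) := by
      intro f
      have h1 := hTf g _ (Lp.memLp f)
      rw [Tfun_of α g (Lp.memLp f), Lp.toLp_coeFn] at h1
      filter_upwards [h1, Lp.coeFn_sub (α.act g f) (α.act g 0)] with x h1 h2
      rw [← h1]
      unfold linPart
      rw [h2]; rfl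
    filter_upwards [ae_fst (p := p) (key f), ae_fst (p := p) (key f')] with y h1 h2
    simp only [DDf, K, KK]
    rw [DDf_KK (hl0 g) h1, DDf_KK (hl0 g) h2]
  · intro f g₀
    simp only [hNN]
    have h := α.continuous f g₀
    simp only [NN_coe_sub] at h
    have := ENNReal.Tendsto.const_mul h (Or.inr hJt)
    rwa [mul_zero] at this
  · rintro ⟨C, hC, h⟩
    apply hunb
    refine ⟨C / J, ENNReal.div_ne_top hC hJ0, fun g => ?_⟩
    have h1 := h g
    rw [hNN] at h1
    rw [ENNReal.le_div_iff_mul_le (Or.inl hJ0) (Or.inl hJt), mul_comm]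
    refine le_trans (le_of_eq ?_) h1
    congr 1
    apply NN_congr
    filter_upwards [hzero] with x hx
    rw [hx]; simp
  · intro n
    have h1 := ae_fst (p := p) (indicatorConstLp_coeFn (p := ENNReal.ofReal p) (hs := hAm n.1)
      (hμs := (hAf n.1).ne) (c := (n.2 : ℂ)))
    filter_upwards [h1, ae_fst (p := p) hzero] with y h1 h2
    unfold DDf
    rw [h1, h2]; rfl
  · intro y y' hyy
    have hyy' : ∀ n : (ℕ × ℕ × Bool) × S,
        DDf ((A n.1).indicator (fun _ => (n.2 : ℂ))) (fun _ => 0) y =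
        DDf ((A n.1).indicator (fun _ => (n.2 : ℂ))) (fun _ => 0) y' := fun n => congrFun hyy n
    simp only [hD0] at hyy'
    have hx : y.1 = y'.1 := by
      by_contra hne
      obtain ⟨n, h1, h2⟩ := hAs _ _ hne
      refine tent_nonconst (r := y.2.1) (w := y.2.2) hSd ?_
      intro c hc
      have := hyy' (n, ⟨c, hc⟩)
      simpa only [if_pos h1, if_neg h2] using this
    obtain ⟨n, hn⟩ := hAc y.1
    have hn' : y'.1 ∈ A n := hx ▸ hn
    have h3 := tent_inj (r := y.2.1) (w := y.2.2) (r' := y'.2.1) (w' := y'.2.2) hSd (by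
      intro c hc
      have := hyy' (n, ⟨c, hc⟩)
      simpa only [if_pos hn, if_pos hn'] using this)
    exact Prod.ext hx (Prod.ext h3.1 h3.2)
  · filter_upwards with y
    by_contra hcon
    push Not at hcon
    obtain ⟨n, hn⟩ := hAc y.1
    refine tent_nonconst (r := y.2.1) (w := y.2.2) hSd ?_
    intro c hc
    have := hcon (n, ⟨c, hc⟩)
    rw [hD0] at this
    simpa only [if_pos hn] using this

end Assemble


section Gauss

open ProbabilityTheory

/-- countable product of standard Gaussians -/
noncomputable def gam (ι : Type) : Measure (ι → ℝ) :=
  Measure.infinitePi (fun _ : ι => gaussianReal 0 1)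

instance gam_prob (ι : Type) : IsProbabilityMeasure (gam ι) := by
  unfold gam; infer_instance

lemma gam_map {ι : Type} (i : ι) : (gam ι).map (fun y => y i) = gaussianReal 0 1 :=
  Measure.infinitePi_map_eval (fun _ : ι => gaussianReal 0 1) i

lemma gam_mp {ι : Type} (i : ι) :
    MeasurePreserving (fun y : ι → ℝ => y i) (gam ι) (gaussianReal 0 1) :=
  ⟨measurable_pi_apply i, gam_map i⟩

lemma gam_memLp {ι : Type} (i : ι) : MemLp (fun y : ι → ℝ => y i) 2 (gam ι) :=
  (memLp_id_gaussianReal' (μ := 0) (v := 1) 2 (by simp)).comp_measurePreserving (gam_mp i)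

lemma gam_indep (ι : Type) : iIndepFun (fun (i : ι) (y : ι → ℝ) => y i) (gam ι) :=
  iIndepFun_infinitePi (P := fun _ : ι => gaussianReal 0 1) (X := fun _ x => x)
    (fun _ => measurable_id)

lemma gam_integral {ι : Type} (i : ι) : ∫ y, y i ∂(gam ι) = 0 := by
  have h := integral_map (μ := gam ι) (φ := fun y : ι → ℝ => y i) (f := fun x : ℝ => x)
    (measurable_pi_apply i).aemeasurable (by fun_prop)
  rw [← h, gam_map]
  exact integral_id_gaussianReal

lemma gam_integral_sq {ι : Type} (i : ι) : ∫ y, y i * y i ∂(gam ι) = 1 := by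
  have h := integral_map (μ := gam ι) (φ := fun y : ι → ℝ => y i) (f := fun x : ℝ => x * x)
    (measurable_pi_apply i).aemeasurable (by fun_prop)
  rw [← h, gam_map]
  have := variance_fun_id_gaussianReal (μ := 0) (v := 1)
  rw [variance_eq_integral (by fun_prop)] at this
  simp only [integral_id_gaussianReal] at this
  simpa [pow_two] using this

lemma gam_integral_mul {ι : Type} {i j : ι} (hij : i ≠ j) : ∫ y, y i * y j ∂(gam ι) = 0 := by
  have h := ((gam_indep ι).indepFun hij).integral_fun_mul_eq_mul_integral
    (measurable_pi_apply i).aestronglyMeasurable (measurable_pi_apply j).aestronglyMeasurable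
  rw [h, gam_integral, zero_mul]

lemma gam_orth (ι : Type) : Orthonormal ℝ (fun i : ι => (gam_memLp i).toLp (fun y : ι → ℝ => y i)) := by
  classical
  rw [orthonormal_iff_ite]
  intro i j
  rw [L2.inner_def]
  have : ∀ᵐ y ∂(gam ι), inner ℝ ((gam_memLp i).toLp (fun y : ι → ℝ => y i) y)
      ((gam_memLp j).toLp (fun y : ι → ℝ => y j) y) = y i * y j := by
    filter_upwards [(gam_memLp i).coeFn_toLp, (gam_memLp j).coeFn_toLp] with y h1 h2
    rw [h1, h2]
    simp [mul_comm]
  rw [integral_congr_ae this]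
  split_ifs with h
  · subst h; exact gam_integral_sq i
  · exact gam_integral_mul h

variable {H : Type} [NormedAddCommGroup H] [InnerProductSpace ℝ H]

theorem exists_W {ι : Type} (b : HilbertBasis ι ℝ H) :
    ∃ W : H →ₗᵢ[ℝ] Lp ℝ 2 (gam ι), ∀ i, W (b i) =ᵐ[gam ι] fun y => y i := by
  classical
  have hV := (gam_orth ι).orthogonalFamily
  refine ⟨hV.linearIsometry.comp b.repr.toLinearIsometry, fun i => ?_⟩
  have : (hV.linearIsometry.comp b.repr.toLinearIsometry) (b i)
      = (gam_memLp i).toLp (fun y : ι → ℝ => y i) := by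
    change hV.linearIsometry (b.repr (b i)) = _
    rw [HilbertBasis.repr_self, OrthogonalFamily.linearIsometry_apply_single]
    simp
  rw [this]
  exact (gam_memLp i).coeFn_toLp

lemma basis_countable [SecondCountableTopology H] {ι : Type} (b : HilbertBasis ι ℝ H) :
    Countable ι := by
  have hd : Pairwise (Function.onFun Disjoint (fun i => Metric.ball (b i) (1 / 2))) := by
    intro i j hij
    apply Metric.ball_disjoint_ball
    have h : ‖b i - b j‖ ^ 2 = 2 := by
      have h1 := b.orthonormal.norm_eq_one i
      have h2 := b.orthonormal.norm_eq_one j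
      have h3 := b.orthonormal.inner_eq_zero hij
      rw [norm_sub_sq_real, h1, h2, h3]; norm_num
    rw [dist_eq_norm]
    nlinarith [norm_nonneg (b i - b j)]
  exact Pairwise.countable_of_isOpen_disjoint hd (fun i => Metric.isOpen_ball)
    (fun i => ⟨b i, Metric.mem_ball_self (by norm_num)⟩)

/-- characteristic functional -/
noncomputable def chF {Y : Type} [MeasurableSpace Y] (ν : Measure Y) (F : Lp ℝ 2 ν) : ℂ :=
  ∫ y, Complex.exp ((F y : ℂ) * Complex.I) ∂ν

lemma chF_lip {Y : Type} [MeasurableSpace Y] (ν : Measure Y) [IsProbabilityMeasure ν] :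
    LipschitzWith 1 (chF ν) := by
  apply LipschitzWith.of_dist_le_mul
  intro F F'
  rw [dist_eq_norm, dist_eq_norm]
  have hi : ∀ F : Lp ℝ 2 ν, Integrable (fun y => Complex.exp ((F y : ℂ) * Complex.I)) ν := by
    intro F
    refine Integrable.of_bound (C := 1) ?_ ?_
    · have := Lp.aestronglyMeasurable F
      have hc : Continuous (fun x : ℝ => Complex.exp ((x : ℂ) * Complex.I)) := by fun_prop
      exact hc.comp_aestronglyMeasurable this
    · filter_upwards with y
      rw [Complex.norm_exp_ofReal_mul_I]
  unfold chF
  rw [← integral_sub (hi F) (hi F')]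
  have hmem := (Lp.memLp (F - F'))
  have hintgr : Integrable (F - F' : Lp ℝ 2 ν) ν := hmem.integrable (by norm_num)
  calc ‖∫ y, (Complex.exp ((F y : ℂ) * Complex.I) - Complex.exp ((F' y : ℂ) * Complex.I)) ∂ν‖
      ≤ ∫ y, ‖(F - F' : Lp ℝ 2 ν) y‖ ∂ν := by
        refine norm_integral_le_of_norm_le hintgr.norm ?_
        filter_upwards [Lp.coeFn_sub F F'] with y hy
        rw [hy]
        have e : Complex.exp ((F y : ℂ) * Complex.I) - Complex.exp ((F' y : ℂ) * Complex.I)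
          = Complex.exp ((F' y : ℂ) * Complex.I) *
            (Complex.exp (Complex.I * ((F y - F' y : ℝ) : ℂ)) - 1) := by
          rw [mul_sub, ← Complex.exp_add]
          push_cast; ring_nf
        rw [e, norm_mul, Complex.norm_exp_ofReal_mul_I, one_mul]
        exact Real.norm_exp_I_mul_ofReal_sub_one_le
    _ ≤ ‖F - F'‖ := by
        rw [Lp.norm_def, integral_norm_eq_lintegral_enorm hintgr.1]
        apply ENNReal.toReal_mono hmem.2.ne
        rw [← eLpNorm_one_eq_lintegral_enorm]
        exact eLpNorm_le_eLpNorm_of_exponent_le (by norm_num) hintgr.1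
    _ = ((1 : NNReal) : ℝ) * ‖F - F'‖ := by simp

end Gauss


section Gauss2

open ProbabilityTheory

variable {H : Type} [NormedAddCommGroup H] [InnerProductSpace ℝ H]

lemma orth_norm_sq {ι : Type} {v : ι → H} (hv : Orthonormal ℝ v) (s : Finset ι) (c : ι → ℝ) :
    ‖∑ i ∈ s, c i • v i‖ ^ 2 = ∑ i ∈ s, c i ^ 2 := by
  rw [← real_inner_self_eq_norm_sq, hv.inner_sum]
  simp [pow_two]

lemma W_finsum {ι κ : Type} (W : H →ₗᵢ[ℝ] Lp ℝ 2 (gam ι)) (s : Finset κ) (c : κ → ℝ) (v : κ → H) :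
    W (∑ i ∈ s, c i • v i) =ᵐ[gam ι] fun y => ∑ i ∈ s, c i * W (v i) y := by
  classical
  induction s using Finset.induction_on with
  | empty =>
    simp only [Finset.sum_empty, map_zero]
    exact Lp.coeFn_zero _ _ _
  | insert a s ha ih =>
    rw [Finset.sum_insert ha, map_add, map_smul]
    filter_upwards [ih, Lp.coeFn_add (c a • W (v a)) (W (∑ i ∈ s, c i • v i)),
      Lp.coeFn_smul (c a) (W (v a))] with y h1 h2 h3
    rw [h2, Pi.add_apply, h1, h3, Finset.sum_insert ha]
    simp

lemma chF_congr {Y : Type} [MeasurableSpace Y] {ν : Measure Y} {F : Lp ℝ 2 ν} {F' : Y → ℝ}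
    (h : F =ᵐ[ν] F') (hF' : AEMeasurable F' ν) : chF ν F = charFun (ν.map F') 1 := by
  rw [charFun_apply_real, integral_map hF' (by fun_prop)]
  unfold chF
  apply integral_congr_ae
  filter_upwards [h] with y hy
  simp [hy]

lemma chF_span {ι : Type} (b : HilbertBasis ι ℝ H) {W : H →ₗᵢ[ℝ] Lp ℝ 2 (gam ι)}
    (hW : ∀ i, W (b i) =ᵐ[gam ι] fun y => y i) (s : Finset ι) (c : ι → ℝ) :
    chF (gam ι) (W (∑ i ∈ s, c i • b i)) =
      Complex.exp (-(((‖∑ i ∈ s, c i • b i‖ ^ 2 : ℝ) : ℂ) / 2)) := by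
  have h1 : W (∑ i ∈ s, c i • b i) =ᵐ[gam ι] fun y => ∑ i ∈ s, c i * y i := by
    have h2 : ∀ᵐ y ∂(gam ι), ∀ i ∈ s, W (b i) y = y i :=
      (Finset.eventually_all s).2 (fun i _ => hW i)
    filter_upwards [W_finsum W s c b, h2] with y h3 h4
    rw [h3]
    exact Finset.sum_congr rfl (fun i hi => by rw [h4 i hi])
  have hind : iIndepFun (fun (i : ι) (y : ι → ℝ) => c i * y i) (gam ι) :=
    iIndepFun_infinitePi (P := fun _ : ι => gaussianReal 0 1) (X := fun i x => c i * x)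
      (fun i => by fun_prop)
  rw [chF_congr h1 (Measurable.aemeasurable (by fun_prop)), iIndepFun.charFun_map_fun_finsetSum_eq_prod
    (X := fun (i : ι) (y : ι → ℝ) => c i * y i) (fun i _ => Measurable.aemeasurable (by fun_prop)) (hind.restrict s),
    orth_norm_sq b.orthonormal, Finset.prod_apply]
  have h5 : ∀ i, charFun ((gam ι).map (fun y : ι → ℝ => c i * y i)) 1
      = Complex.exp (-(((c i ^ 2 : ℝ) : ℂ) / 2)) := by
    intro i
    have : (gam ι).map (fun y : ι → ℝ => c i * y i) = gaussianReal 0 (.mk (c i ^ 2) (sq_nonneg _)) := by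
      have h6 := gaussianReal_map_const_mul (μ := 0) (v := 1) (c i)
      rw [← gam_map i, Measure.map_map (by fun_prop) (by fun_prop), mul_zero, mul_one] at h6
      exact h6
    rw [this, charFun_gaussianReal]
    simp
  simp_rw [h5]
  rw [← Complex.exp_sum]
  congr 1
  rw [Finset.sum_neg_distrib, ← Finset.sum_div]
  push_cast
  rfl

lemma chF_W {ι : Type} (b : HilbertBasis ι ℝ H) {W : H →ₗᵢ[ℝ] Lp ℝ 2 (gam ι)}
    (hW : ∀ i, W (b i) =ᵐ[gam ι] fun y => y i) (h : H) :
    chF (gam ι) (W h) = Complex.exp (-(((‖h‖ ^ 2 : ℝ) : ℂ) / 2)) := by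
  have hcl : IsClosed {h : H | chF (gam ι) (W h) = Complex.exp (-(((‖h‖ ^ 2 : ℝ) : ℂ) / 2))} := by
    apply isClosed_eq
    · exact (chF_lip _).continuous.comp W.continuous
    · fun_prop
  have hsub : (Submodule.span ℝ (Set.range b) : Set H) ⊆
      {h : H | chF (gam ι) (W h) = Complex.exp (-(((‖h‖ ^ 2 : ℝ) : ℂ) / 2))} := by
    intro x hx
    obtain ⟨c, rfl⟩ := Finsupp.mem_span_range_iff_exists_finsupp.1 hx
    exact chF_span b hW c.support c
  have hd := b.dense_span
  have hx : h ∈ closure (Submodule.span ℝ (Set.range b) : Set H) := by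
    rw [← Submodule.topologicalClosure_coe, hd]; trivial
  exact closure_minimal hsub hcl hx

lemma W_law {ι : Type} (b : HilbertBasis ι ℝ H) {W : H →ₗᵢ[ℝ] Lp ℝ 2 (gam ι)}
    (hW : ∀ i, W (b i) =ᵐ[gam ι] fun y => y i) (h : H) :
    (gam ι).map (W h) = gaussianReal 0 (.mk (‖h‖ ^ 2) (sq_nonneg _)) := by
  have hm : Measurable (W h) := (Lp.stronglyMeasurable (W h)).measurable
  have : IsProbabilityMeasure ((gam ι).map (W h)) := Measure.isProbabilityMeasure_map hm.aemeasurable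
  apply Measure.ext_of_charFun
  ext t
  have h1 : charFun ((gam ι).map (W h)) t = chF (gam ι) (W (t • h)) := by
    rw [charFun_apply_real, integral_map hm.aemeasurable (by fun_prop)]
    unfold chF
    apply integral_congr_ae
    rw [map_smul]
    filter_upwards [Lp.coeFn_smul t (W h)] with y hy
    rw [hy]; simp
  rw [h1, chF_W b hW, charFun_gaussianReal, norm_smul]
  congr 1
  simp [mul_pow]
  norm_cast
  ring

lemma W_mp {ι : Type} (b : HilbertBasis ι ℝ H) {W : H →ₗᵢ[ℝ] Lp ℝ 2 (gam ι)}
    (hW : ∀ i, W (b i) =ᵐ[gam ι] fun y => y i) {v : ι → H} (hv : Orthonormal ℝ v) :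
    MeasurePreserving (fun y i => W (v i) y) (gam ι) (gam ι) := by
  have hm : ∀ i, Measurable (W (v i)) := fun i => (Lp.stronglyMeasurable (W (v i))).measurable
  have hlaw : ∀ i, (gam ι).map (W (v i)) = gaussianReal 0 1 := by
    intro i
    rw [W_law b hW]
    congr 1
    ext
    simp [hv.norm_eq_one i]
  refine ⟨measurable_pi_iff.2 hm, ?_⟩
  have hind : iIndepFun (fun i y => W (v i) y) (gam ι) := by
    rw [iIndepFun_iff_finset]
    intro s
    rw [iIndepFun_iff_charFun_pi (X := s.restrict (fun i y => W (v i) y))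
      (fun i => (hm i).aemeasurable)]
    intro t
    have e1 : ∀ i : s, charFun ((gam ι).map (s.restrict (fun i y => W (v i) y) i)) (t i)
        = Complex.exp (-(((t i ^ 2 : ℝ) : ℂ) / 2)) := by
      intro i
      have : (gam ι).map (s.restrict (fun i y => W (v i) y) i) = gaussianReal 0 1 := hlaw i
      rw [this, charFun_gaussianReal]
      simp
    simp_rw [e1]
    have hjm : Measurable (fun y => WithLp.toLp 2
        (fun i : s => s.restrict (fun i y => W (v i) y) i y)) := by
      simp only [Finset.restrict]
      fun_prop
    rw [← Complex.exp_sum, charFun_apply, integral_map hjm.aemeasurable (by fun_prop)]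
    have e2 := chF_W b hW (∑ i : s, t i • v i)
    have hv' : Orthonormal ℝ (fun i : s => v i) := hv.comp _ Subtype.val_injective
    rw [orth_norm_sq hv'] at e2
    have e3 : (∑ i : s, -(((t i ^ 2 : ℝ) : ℂ) / 2)) = -(((∑ i : s, t i ^ 2 : ℝ) : ℂ) / 2) := by
      rw [Finset.sum_neg_distrib, ← Finset.sum_div]
      push_cast
      rfl
    rw [e3, ← e2]
    unfold chF
    apply integral_congr_ae
    filter_upwards [W_finsum W Finset.univ (fun i : s => t i) (fun i : s => v i)] with y hy
    rw [hy, PiLp.inner_apply]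
    simp
  have := hind.map_fun_eq_infinitePi_map hm
  rw [this]
  simp_rw [hlaw]
  rfl

/-- the absolute moment -/
noncomputable def cq (q : ℝ) : ℝ≥0∞ := NN (gaussianReal 0 1) q (fun x : ℝ => x)

lemma cq_top {q : ℝ} (hq : 0 < q) : cq q ≠ ⊤ :=
  (((memLp_iff_NN hq).1 (memLp_id_gaussianReal' (μ := 0) (v := 1) (ENNReal.ofReal q) (by simp))).2).ne

lemma gauss_ne_zero : ∀ᵐ x ∂(gaussianReal 0 1), x ≠ 0 := by
  have := nullSingletonClass_gaussianReal (μ := 0) (v := 1) one_ne_zero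
  rw [ae_iff]
  simp

lemma cq_zero {q : ℝ} (hq : 0 < q) : cq q ≠ 0 := by
  intro h
  have h1 := (NN_eq_zero_iff hq (by fun_prop)).1 h
  have h2 : ∀ᵐ x ∂(gaussianReal 0 1), False := by
    filter_upwards [h1, gauss_ne_zero] with x h3 h4
    exact h4 h3
  exact (h2.exists).elim (fun _ h => h)

lemma NN_W {ι : Type} (b : HilbertBasis ι ℝ H) {W : H →ₗᵢ[ℝ] Lp ℝ 2 (gam ι)}
    (hW : ∀ i, W (b i) =ᵐ[gam ι] fun y => y i) {q : ℝ} (hq : 0 < q) (h : H) :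
    NN (gam ι) q (W h) = cq q * ‖h‖ₑ ^ q := by
  have hm : Measurable (W h) := (Lp.stronglyMeasurable (W h)).measurable
  have hlaw := W_law b hW h
  have h6 := gaussianReal_map_const_mul (μ := 0) (v := 1) ‖h‖
  rw [mul_zero, mul_one, ← hlaw] at h6
  have hf : Measurable (fun x : ℝ => ‖x‖ₑ ^ q) := by fun_prop
  have e1 : NN (gam ι) q (W h) = ∫⁻ x, ‖x‖ₑ ^ q ∂((gam ι).map (W h)) := by
    rw [lintegral_map hf hm]; rfl
  rw [e1, ← h6, lintegral_map hf (by fun_prop)]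
  have e2 : ∀ x : ℝ, ‖‖h‖ * x‖ₑ ^ q = ‖x‖ₑ ^ q * ‖h‖ₑ ^ q := by
    intro x
    rw [enorm_mul, ENNReal.mul_rpow_of_nonneg _ _ hq.le, enorm_norm, mul_comm]
  simp_rw [e2]
  rw [lintegral_mul_const _ hf]
  rfl

end Gauss2


section Gauss3

open ProbabilityTheory

theorem gauss_case {G : Type*} [Group G] [TopologicalSpace G] {q : ℝ} (hq : 0 < q)
    {H : Type} [NormedAddCommGroup H] [InnerProductSpace ℝ H] [CompleteSpace H]
    [SecondCountableTopology H] (α : G → H → H) (h_one : ∀ x, α 1 x = x)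
    (h_mul : ∀ g h x, α (g * h) x = α g (α h x)) (T : G → H →ₗᵢ[ℝ] H)
    (hT : ∀ g x y, α g x - α g y = T g (x - y))
    (hcont : ∀ x g₀, Tendsto (fun g => ‖α g x - α g₀ x‖) (𝓝 g₀) (𝓝 0))
    (hunb : ¬ ∃ C : ℝ, ∀ g, ‖α g 0‖ ≤ C) :
    ∃ (Y : Type) (_ : MeasurableSpace Y) (ν : Measure Y),
      StandardBorelSpace Y ∧ SigmaFinite ν ∧
      ∃ β : AffineIsometricAction G ν q, β.HasUnboundedOrbit := by
  obtain ⟨w, b, -⟩ := exists_hilbertBasis ℝ H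
  obtain ⟨W, hW⟩ := exists_W b
  have hc : Countable w := basis_countable b
  have hm : ∀ x, Measurable (W x) := fun x => (Lp.stronglyMeasurable (W x)).measurable
  have hNN := fun x => NN_W b hW hq x
  have hK : ∀ g, MeasurePreserving (fun y (i : w) => W (T g (b i)) y) (gam w) (gam w) := fun g =>
    W_mp b hW (b.orthonormal.comp_linearIsometry (T g))
  have hWK : ∀ g x, (fun y => W x (fun i : w => W (T g (b i)) y)) =ᵐ[gam w] W (T g x) := by
    intro g x
    let L : Lp ℝ 2 (gam w) →ₗᵢ[ℝ] Lp ℝ 2 (gam w) := Lp.compMeasurePreservingₗᵢ ℝ _ (hK g)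
    have hL : ∀ F : Lp ℝ 2 (gam w), L F =ᵐ[gam w] fun y => F (fun i : w => W (T g (b i)) y) :=
      fun F => Lp.coeFn_compMeasurePreserving F (hK g)
    have heq : (L.comp W).toContinuousLinearMap = (W.comp (T g)).toContinuousLinearMap := by
      apply ContinuousLinearMap.ext_on (s := Set.range b)
      · have := b.dense_span
        rwa [← Submodule.dense_iff_topologicalClosure_eq_top] at this
      · rintro _ ⟨i, rfl⟩
        change L (W (b i)) = W (T g (b i))
        apply Lp.ext
        refine (hL _).trans ?_
        exact (hK g).quasiMeasurePreserving.ae (hW i)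
    have : L (W x) = W (T g x) := congrArg (fun f => f x) heq
    rw [← this]
    exact (hL _).symm
  refine ⟨w → ℝ, inferInstance, gam w, inferInstance, inferInstance, ?_⟩
  refine framework (gam w) hq α h_one h_mul (fun g y (i : w) => W (T g (b i)) y) hK
    (fun x x' => W (x - x')) (fun x x' => (hm _).aestronglyMeasurable) ?_ ?_ ?_ ?_ 0 ?_
    (s := fun i : w => b i) (u := fun i y => y i) (fun i => measurable_pi_apply i) ?_ ?_ ?_
  · intro x x'
    rw [hNN]
    exact ENNReal.mul_lt_top (cq_top hq).lt_top (ENNReal.rpow_lt_top_of_nonneg hq.le (by simp))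
  · intro x y z
    have : x - z = (x - y) + (y - z) := by abel
    rw [this, map_add]
    exact Lp.coeFn_add _ _
  · intro g x y
    rw [hT]
    exact hWK g _
  · intro x g₀
    simp_rw [hNN]
    have h1 : Tendsto (fun g => ‖α g x - α g₀ x‖ₑ) (𝓝 g₀) (𝓝 0) := by
      have := ENNReal.tendsto_ofReal (hcont x g₀)
      simpa [ofReal_norm] using this
    have h2 := (ENNReal.continuous_rpow_const (y := q)).tendsto 0 |>.comp h1
    rw [ENNReal.zero_rpow_of_pos hq] at h2
    have h3 := ENNReal.Tendsto.const_mul (a := cq q) h2 (Or.inr (cq_top hq))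
    rw [mul_zero] at h3
    exact h3
  · rintro ⟨C, hC, h⟩
    apply hunb
    refine ⟨((C / cq q) ^ (1 / q)).toReal, fun g => ?_⟩
    have h1 := h g
    rw [hNN, sub_zero] at h1
    have h2 : ‖α g 0‖ₑ ^ q ≤ C / cq q := by
      rw [ENNReal.le_div_iff_mul_le (Or.inl (cq_zero hq)) (Or.inl (cq_top hq)), mul_comm]
      exact h1
    have h3 : ‖α g 0‖ₑ ≤ (C / cq q) ^ (1 / q) := by
      have := ENNReal.rpow_le_rpow h2 (show 0 ≤ 1 / q by positivity)
      rwa [← ENNReal.rpow_mul, mul_one_div_cancel hq.ne', ENNReal.rpow_one] at this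
    have h4 := ENNReal.toReal_mono (ENNReal.rpow_ne_top_of_nonneg (by positivity)
      (ENNReal.div_ne_top hC (cq_zero hq))) h3
    simpa using h4
  · intro i
    simp only [sub_zero]
    exact (hW i).symm
  · intro y y' h
    exact h
  · have hne : Nonempty w := by
      by_contra hn
      rw [not_nonempty_iff] at hn
      apply hunb
      have hd := b.dense_span
      rw [Set.range_eq_empty, Submodule.span_empty] at hd
      have hs : ∀ x : H, x = 0 := by
        intro x
        have hx : x ∈ (⊥ : Submodule ℝ H).topologicalClosure := by rw [hd]; trivial
        rw [(Submodule.closed_of_finiteDimensional (⊥ : Submodule ℝ H)).submodule_topologicalClosure_eq] at hx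
        simpa using hx
      exact ⟨0, fun g => by rw [hs (α g 0)]; simp⟩
    obtain ⟨i⟩ := hne
    filter_upwards [(gam_mp i).quasiMeasurePreserving.ae gauss_ne_zero] with y hy
    exact ⟨i, hy⟩

theorem case_two_aux {G : Type*} [Group G] [TopologicalSpace G] {q : ℝ} (hq : 0 < q)
    {X : Type} [MeasurableSpace X] [StandardBorelSpace X] {μ : Measure X} [SigmaFinite μ]
    {e : ℝ≥0∞} (he : e = 2)
    (α : G → Lp ℂ e μ → Lp ℂ e μ) (h_one : ∀ x, α 1 x = x)
    (h_mul : ∀ g h x, α (g * h) x = α g (α h x))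
    (T : G → Lp ℂ e μ → Lp ℂ e μ)
    (hTa : ∀ g x y, T g (x + y) = T g x + T g y)
    (hTs : ∀ g (t : ℝ) x, T g (t • x) = t • T g x)
    (hTi : ∀ g x, ‖T g x‖ = ‖x‖)
    (hT : ∀ g x y, α g x - α g y = T g (x - y))
    (hcont : ∀ x g₀, Tendsto (fun g => ‖α g x - α g₀ x‖) (𝓝 g₀) (𝓝 0))
    (hunb : ¬ ∃ C : ℝ, ∀ g, ‖α g 0‖ ≤ C) :
    ∃ (Y : Type) (_ : MeasurableSpace Y) (ν : Measure Y),
      StandardBorelSpace Y ∧ SigmaFinite ν ∧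
      ∃ β : AffineIsometricAction G ν q, β.HasUnboundedOrbit := by
  subst he
  letI : InnerProductSpace ℝ (Lp ℂ 2 μ) := MeasureTheory.L2.innerProductSpace
  have : Fact ((2 : ℝ≥0∞) ≠ ⊤) := ⟨by simp⟩
  have : SecondCountableTopology (Lp ℂ 2 μ) := inferInstance
  exact gauss_case hq α h_one h_mul
    (fun g => { toFun := T g, map_add' := hTa g, map_smul' := hTs g, norm_map' := hTi g })
    hT hcont hunb

theorem case_two {G : Type*} [Group G] [TopologicalSpace G] {q : ℝ} (hq : 0 < q)
    {X : Type} [MeasurableSpace X] [StandardBorelSpace X] {μ : Measure X} [SigmaFinite μ]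
    (α : AffineIsometricAction G μ 2) (hα : α.HasUnboundedOrbit) :
    ∃ (Y : Type) (_ : MeasurableSpace Y) (ν : Measure Y),
      StandardBorelSpace Y ∧ SigmaFinite ν ∧
      ∃ β : AffineIsometricAction G ν q, β.HasUnboundedOrbit := by
  have h2 : (0 : ℝ) < 2 := two_pos
  have hn : ∀ f : Lp ℂ (ENNReal.ofReal 2) μ, ‖f‖ = ((NN μ 2 (fun x => f x)) ^ (1 / 2 : ℝ)).toReal := by
    intro f
    rw [Lp.norm_def, eLpNorm_eq_NN h2]
  have hns : ∀ f f' : Lp ℂ (ENNReal.ofReal 2) μ, ‖f - f'‖ =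
      ((pPow μ 2 ((f : X →ₘ[μ] ℂ) - (f' : X →ₘ[μ] ℂ))) ^ (1 / 2 : ℝ)).toReal := by
    intro f f'
    rw [hn, NN_coe_sub]
    congr 2
    exact NN_congr (Lp.coeFn_sub f f')
  have hunb := unb_zero h2 α hα
  refine case_two_aux hq (e := ENNReal.ofReal 2) (by simp) α.act α.act_one α.act_mul (linPart α)
    (linPart_add α) (linPart_smul α) ?_ ?_ ?_ ?_
  · intro g x
    have h := hns (α.act g x) (α.act g 0)
    rw [α.isometry, ← hns, sub_zero] at h
    exact h
  · intro g x y
    rw [linPart_sub]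
    unfold linPart
    abel
  · intro x g₀
    simp_rw [hns]
    have h1 := (ENNReal.continuous_rpow_const (y := (1 / 2 : ℝ))).tendsto 0 |>.comp
      (α.continuous x g₀)
    rw [ENNReal.zero_rpow_of_pos (by norm_num)] at h1
    have h3 := (ENNReal.tendsto_toReal (a := 0) (by simp)).comp h1
    exact h3
  · rintro ⟨C, hC⟩
    apply hunb
    refine ⟨(ENNReal.ofReal C) ^ (2 : ℝ), ENNReal.rpow_ne_top_of_nonneg (by norm_num) (by simp),
      fun g => ?_⟩
    have h1 := hC g
    have hfin := ((memLp_iff_NN h2).1 (Lp.memLp (α.act g 0))).2.ne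
    rw [hn] at h1
    have h3 := (ENNReal.le_ofReal_iff_toReal_le (ENNReal.rpow_ne_top_of_nonneg (by norm_num) hfin)
      (le_trans ENNReal.toReal_nonneg h1)).2 h1
    have h4 := ENNReal.rpow_le_rpow h3 h2.le
    rw [← ENNReal.rpow_mul] at h4
    norm_num at h4 ⊢
    exact h4

end Gauss3

/-- **Corollary (i).** For a topological group `G`, the set of `p ∈ (0,∞)` such that `G`
admits a continuous affine isometric action on an `L_p` space with unbounded orbits is
upward closed: if `0 < p < q < ∞` and `G` admits such an action on some `L_p` space,
then it admits one on some `L_q` space. -/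
theorem stmt1 {G : Type*} [Group G] [TopologicalSpace G] [IsTopologicalGroup G]
    {p q : ℝ} (hp : 0 < p) (hpq : p < q)
    (h : ∃ (X : Type) (_ : MeasurableSpace X) (μ : Measure X),
      StandardBorelSpace X ∧ SigmaFinite μ ∧
      ∃ α : AffineIsometricAction G μ p, α.HasUnboundedOrbit) :
    ∃ (Y : Type) (_ : MeasurableSpace Y) (ν : Measure Y),
      StandardBorelSpace Y ∧ SigmaFinite ν ∧
      ∃ β : AffineIsometricAction G ν q, β.HasUnboundedOrbit := by
  obtain ⟨X, mX, μ, hX, hμ, α, hα⟩ := h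
  by_cases hp2 : p = 2
  · subst hp2
    exact case_two (hp.trans hpq) α hα
  · exact ⟨X × ℝ × ℂ, inferInstance, nuu μ p, inferInstance, inferInstance,
      case_ne_two hp hp2 hpq α hα⟩
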